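/- Let p ∈ (1,∞), N ≥ 2, and let Ω ⊂ ℝ^N be an open bounded convex domain with diameter D_Ω. If ū is a first eigenfunction associated with the Neumann eigenvalue μ_p(Ω), then ‖ū‖_{L^∞(Ω)} ≤ K_∞(N)·μ_p(Ω)^{N/p}·(D_Ω^N/|Ω|^{1/p})·‖ū‖_{L^p(Ω)}, where K_∞(N) := 2^{2N}·ω_N^{−1}·(1+4N^{N+1})^N·(N/(N−1))^{N(N−1)} and ω_N is the Lebesgue measure of the unit ball of ℝ^N. -/

import Mathlib

open MeasureTheory Set Filter Topology

/-- `π_p := 2π (p-1)^{1/p} / (p sin(π/p))`. -/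
noncomputable def piP (p : ℝ) : ℝ :=
  2 * Real.pi * (p - 1) ^ (1 / p) / (p * Real.sin (Real.pi / p))

/-- The first nontrivial Neumann `p`-Laplacian eigenvalue of `Ω` with weight `φ`. -/
noncomputable def muP (p : ℝ) {N : ℕ} (Ω : Set (EuclideanSpace ℝ (Fin N)))
    (φ : EuclideanSpace ℝ (Fin N) → ℝ) : ℝ :=
  sInf { r : ℝ | ∃ (u : EuclideanSpace ℝ (Fin N) → ℝ) (K : NNReal),
    LipschitzWith K u ∧
    ¬ (∀ᵐ x ∂(volume.restrict Ω), u x = 0) ∧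
    (∫ x in Ω, φ x * |u x| ^ (p - 2) * u x) = 0 ∧
    r = (∫ x in Ω, φ x * ‖fderiv ℝ u x‖ ^ p) / (∫ x in Ω, φ x * |u x| ^ p) }

/-- A first eigenfunction for `μ_p(Ω,φ)`: a locally Lipschitz (on `Ω`) function, not a.e.
zero, with `∫_Ω φ |u|^{p-2} u = 0`, finite weighted energy and `p`-norm, realizing the
infimum: `∫_Ω φ |∇u|^p = μ_p(Ω,φ) ∫_Ω φ |u|^p`. -/
def IsFirstEigenfunction (p : ℝ) {N : ℕ} (Ω : Set (EuclideanSpace ℝ (Fin N)))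
    (φ : EuclideanSpace ℝ (Fin N) → ℝ) (u : EuclideanSpace ℝ (Fin N) → ℝ) : Prop :=
  (∀ x ∈ Ω, ∃ (K : NNReal) (t : Set (EuclideanSpace ℝ (Fin N))),
      t ∈ nhdsWithin x Ω ∧ LipschitzOnWith K u t) ∧
  ¬ (∀ᵐ x ∂(volume.restrict Ω), u x = 0) ∧
  IntegrableOn (fun x => φ x * |u x| ^ p) Ω volume ∧
  IntegrableOn (fun x => φ x * ‖fderiv ℝ u x‖ ^ p) Ω volume ∧
  (∫ x in Ω, φ x * |u x| ^ (p - 2) * u x) = 0 ∧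
  (∫ x in Ω, φ x * ‖fderiv ℝ u x‖ ^ p) = muP p Ω φ * ∫ x in Ω, φ x * |u x| ^ p

/-- The constant `K_∞(k) = 2^{2k} ω_k^{-1} (1+4k^{k+1})^k (k/(k-1))^{k(k-1)}`, where `ω_k`
is the volume of the unit ball of `ℝ^k`. -/
noncomputable def Kinf (k : ℕ) : ℝ :=
  2 ^ (2 * k) * ((volume (Metric.ball (0 : EuclideanSpace ℝ (Fin k)) 1)).toReal)⁻¹ *
    (1 + 4 * (k : ℝ) ^ (k + 1)) ^ k * ((k : ℝ) / ((k : ℝ) - 1)) ^ (k * (k - 1))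

section SegmentEstimates

open Module
open scoped ENNReal

variable {E : Type*} [NormedAddCommGroup E] [NormedSpace ℝ E] [MeasurableSpace E] [BorelSpace E]

theorem measurableEmbedding_affine {a : ℝ} (ha : 0 < a) (b : E) :
    MeasurableEmbedding (fun x : E => a • x + b) :=
  (measurableEmbedding_addRight b).comp (measurableEmbedding_const_smul₀ ha.ne')

theorem rpow_setLIntegral_Ioo_le {p : ℝ} (hp : 1 < p) (l : ℝ) {f : ℝ → ℝ≥0∞}
    (hf : Measurable f) :
    (∫⁻ t in Ioo 0 l, f t) ^ p ≤ ENNReal.ofReal l ^ (p - 1) * ∫⁻ t in Ioo 0 l, f t ^ p := by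
  have hpq := Real.HolderConjugate.conjExponent hp
  have h := ENNReal.lintegral_mul_le_Lp_mul_Lq (volume.restrict (Ioo 0 l)) hpq
    hf.aemeasurable (aemeasurable_const (b := (1 : ℝ≥0∞)))
  simp only [Pi.mul_apply, mul_one, ENNReal.one_rpow, lintegral_const, one_mul,
    Measure.restrict_apply MeasurableSet.univ, univ_inter, Real.volume_Ioo, sub_zero] at h
  have hp0 : 0 < p := by linarith
  calc _ ≤ ((∫⁻ t in Ioo 0 l, f t ^ p) ^ (1 / p) *
        ENNReal.ofReal l ^ (1 / p.conjExponent)) ^ p := by gcongr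
    _ = _ := by
      rw [ENNReal.mul_rpow_of_nonneg _ _ hp0.le, ← ENNReal.rpow_mul, ← ENNReal.rpow_mul,
        one_div_mul_cancel hp0.ne', ENNReal.rpow_one, mul_comm]
      congr 2
      rw [Real.conjExponent]
      have : p - 1 ≠ 0 := by linarith
      field_simp

theorem enorm_sub_rpow_le_lintegral_fderiv {p : ℝ} (hp : 1 < p) {s : Set E}
    (hc : Convex ℝ s) {f : E → ℝ} (hf : LocallyLipschitzOn s f) {x z : E} (hx : x ∈ s)
    (hz : z ∈ s) {l : ℝ} (hl : 0 < l) (hl1 : l ≤ 1)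
    (hd : ∀ᵐ t ∂(volume.restrict (Ioo 0 l)), DifferentiableAt ℝ f ((1 - t) • x + t • z)) :
    ‖f x - f ((1 - l) • x + l • z)‖ₑ ^ p ≤ ENNReal.ofReal l ^ (p - 1) * ‖z - x‖ₑ ^ p *
      ∫⁻ t in Ioo 0 l, ‖fderiv ℝ f ((1 - t) • x + t • z)‖ₑ ^ p := by
  set γ : ℝ → E := fun t => (1 - t) • x + t • z with hγ
  have hγd (t : ℝ) : HasDerivAt γ (z - x) t := by
    have := (((hasDerivAt_id' t).const_sub 1).smul_const x).fun_add
      ((hasDerivAt_id' t).smul_const z)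
    convert this using 1
    module
  have hγc : Continuous γ := by fun_prop
  have hsub : γ '' Icc 0 l ⊆ s := by
    rintro _ ⟨t, ht, rfl⟩
    exact hc hx hz (by linarith [ht.2]) ht.1 (by ring)
  obtain ⟨K, hK⟩ := (hf.mono hsub).exists_lipschitzOnWith_of_compact
    (isCompact_Icc.image hγc)
  obtain ⟨K', hK'⟩ : ∃ K', LipschitzWith K' γ := by
    refine ⟨‖z - x‖₊, lipschitzWith_of_nnnorm_deriv_le (fun t => (hγd t).differentiableAt)
      fun t => ?_⟩
    rw [(hγd t).deriv]
  have hac : AbsolutelyContinuousOnInterval (f ∘ γ) 0 l := by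
    apply LipschitzOnWith.absolutelyContinuousOnInterval (K := K * K')
    rw [uIcc_of_le hl.le]
    exact hK.comp hK'.lipschitzOnWith (mapsTo_image _ _)
  have hftc := hac.integral_deriv_eq_sub
  have hmeas : Measurable fun t => ‖fderiv ℝ f (γ t)‖ₑ :=
    ((measurable_fderiv ℝ f).comp hγc.measurable).enorm
  have hbound : ‖f x - f (γ l)‖ₑ ≤ ‖z - x‖ₑ * ∫⁻ t in Ioo 0 l, ‖fderiv ℝ f (γ t)‖ₑ := by
    have h0 : f x - f (γ l) = -∫ t in (0 : ℝ)..l, deriv (f ∘ γ) t := by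
      rw [hftc]; simp [hγ]
    rw [h0, enorm_neg, intervalIntegral.integral_of_le hl.le, integral_Ioc_eq_integral_Ioo]
    refine (enorm_integral_le_lintegral_enorm _).trans ?_
    rw [← lintegral_const_mul _ hmeas]
    refine lintegral_mono_ae ?_
    filter_upwards [hd] with t ht
    rw [(ht.hasFDerivAt.comp_hasDerivAt t (hγd t)).deriv, mul_comm]
    exact (fderiv ℝ f (γ t)).le_opENorm _
  have hp0 : 0 ≤ p := by linarith
  calc _ ≤ (‖z - x‖ₑ * ∫⁻ t in Ioo 0 l, ‖fderiv ℝ f (γ t)‖ₑ) ^ p := by gcongr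
    _ ≤ ‖z - x‖ₑ ^ p * (ENNReal.ofReal l ^ (p - 1) *
        ∫⁻ t in Ioo 0 l, ‖fderiv ℝ f (γ t)‖ₑ ^ p) := by
      rw [ENNReal.mul_rpow_of_nonneg _ _ hp0]
      gcongr
      exact rpow_setLIntegral_Ioo_le hp l hmeas
    _ = _ := by ring

variable [FiniteDimensional ℝ E] (ν : Measure E) [ν.IsAddHaarMeasure]

theorem map_affine_addHaar {a : ℝ} (ha : 0 < a) (b : E) :
    ν.map (fun x => a • x + b) = ENNReal.ofReal (a ^ finrank ℝ E)⁻¹ • ν := by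
  have h := Measure.map_addHaar_smul ν ha.ne'
  rw [abs_of_pos (by positivity)] at h
  have hcomp : (fun x : E => a • x + b) = (fun x => x + b) ∘ (fun x => a • x) := rfl
  rw [hcomp, ← Measure.map_map (measurable_add_const b) (measurable_const_smul a), h,
    Measure.map_smul, map_add_right_eq_self]

theorem setLIntegral_comp_affine {a : ℝ} (ha : 0 < a) (b : E) (s : Set E) (f : E → ℝ≥0∞) :
    ∫⁻ x in (fun x => a • x + b) ⁻¹' s, f (a • x + b) ∂ν
      = ENNReal.ofReal (a ^ finrank ℝ E)⁻¹ * ∫⁻ x in s, f x ∂ν := by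
  rw [← smul_eq_mul, ← lintegral_smul_measure, ← Measure.restrict_smul,
    ← map_affine_addHaar ν ha b, (measurableEmbedding_affine ha b).restrict_map,
    (measurableEmbedding_affine ha b).lintegral_map]

theorem setIntegral_comp_affine {a : ℝ} (ha : 0 < a) (b : E) (s : Set E) (f : E → ℝ) :
    ∫ x in (fun x => a • x + b) ⁻¹' s, f (a • x + b) ∂ν
      = (a ^ finrank ℝ E)⁻¹ * ∫ x in s, f x ∂ν := by
  have h := integral_smul_measure (μ := ν.restrict s) f (ENNReal.ofReal (a ^ finrank ℝ E)⁻¹)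
  rw [ENNReal.toReal_ofReal (by positivity), smul_eq_mul] at h
  rw [← h, ← Measure.restrict_smul, ← map_affine_addHaar ν ha b,
    (measurableEmbedding_affine ha b).restrict_map, (measurableEmbedding_affine ha b).integral_map]

theorem measure_preimage_affine {a : ℝ} (ha : 0 < a) (b : E) (s : Set E) :
    ν ((fun x => a • x + b) ⁻¹' s) = ENNReal.ofReal (a ^ finrank ℝ E)⁻¹ * ν s := by
  rw [← (measurableEmbedding_affine ha b).map_apply, map_affine_addHaar ν ha b]
  rfl

theorem setLIntegral_comp_affine_le {a : ℝ} (ha : 0 < a) (b : E) {s : Set E}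
    (hs : ∀ x ∈ s, a • x + b ∈ s) (f : E → ℝ≥0∞) :
    ∫⁻ x in s, f (a • x + b) ∂ν ≤ ENNReal.ofReal (a ^ finrank ℝ E)⁻¹ * ∫⁻ x in s, f x ∂ν := by
  rw [← setLIntegral_comp_affine ν ha b]
  exact lintegral_mono_set hs

theorem LocallyLipschitzOn.ae_differentiableAt {s : Set E} (hs : IsOpen s) {f : E → ℝ}
    (hf : LocallyLipschitzOn s f) : ∀ᵐ x ∂ν, x ∈ s → DifferentiableAt ℝ f x := by
  change ν {x | ¬(x ∈ s → DifferentiableAt ℝ f x)} = 0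
  refine measure_null_of_locally_null _ fun x hx => ?_
  have hxs : x ∈ s := by
    by_contra h
    exact hx fun h' => absurd h' h
  obtain ⟨K, t, ht, hK⟩ := hf hxs
  rw [hs.nhdsWithin_eq hxs] at ht
  obtain ⟨o, hot, ho, hxo⟩ := mem_nhds_iff.1 ht
  refine ⟨{y | ¬(y ∈ s → DifferentiableAt ℝ f y)} ∩ o,
    inter_mem_nhdsWithin _ (ho.mem_nhds hxo), ?_⟩
  refine measure_mono_null ?_ ((hK.mono hot).ae_differentiableWithinAt_of_mem (μ := ν))
  rintro y ⟨hy, hyo⟩ hd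
  exact hy fun _ => (hd hyo).differentiableAt (ho.mem_nhds hyo)

theorem lintegral_segments_le {s : Set E} (hc : Convex ℝ s) (hm : MeasurableSet s) {l : ℝ}
    (hl : 0 < l) (hl1 : l < 1) {g : E → ℝ≥0∞} (hg : Measurable g) :
    ∫⁻ x in s, ∫⁻ z in s, (∫⁻ t in Ioo 0 l, g ((1 - t) • x + t • z)) ∂ν ∂ν ≤
      ENNReal.ofReal (l * ((1 - l) ^ finrank ℝ E)⁻¹) * ν s * ∫⁻ x in s, g x ∂ν := by
  have hswap (x : E) : ∫⁻ z in s, (∫⁻ t in Ioo 0 l, g ((1 - t) • x + t • z)) ∂ν =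
      ∫⁻ t in Ioo 0 l, ∫⁻ z in s, g ((1 - t) • x + t • z) ∂ν :=
    lintegral_lintegral_swap (f := fun z t => g ((1 - t) • x + t • z))
      (hg.comp (by fun_prop)).aemeasurable
  have hmeas : Measurable (fun q : E × ℝ => ∫⁻ z in s, g ((1 - q.2) • q.1 + q.2 • z) ∂ν) :=
    Measurable.lintegral_prod_right' (ν := ν.restrict s)
      (f := fun r : (E × ℝ) × E => g ((1 - r.1.2) • r.1.1 + r.1.2 • r.2)) (hg.comp (by fun_prop))
  simp_rw [hswap]
  rw [lintegral_lintegral_swap (f := fun x t => ∫⁻ z in s, g ((1 - t) • x + t • z) ∂ν)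
    hmeas.aemeasurable]
  calc _ ≤ ∫⁻ _ in Ioo 0 l, ENNReal.ofReal ((1 - l) ^ finrank ℝ E)⁻¹ * ν s *
        ∫⁻ x in s, g x ∂ν := by
        refine setLIntegral_mono' measurableSet_Ioo fun t ht => ?_
        rw [lintegral_lintegral_swap (f := fun x z => g ((1 - t) • x + t • z))
          (hg.comp (by fun_prop)).aemeasurable]
        have ht1 : 0 < 1 - t := by linarith [ht.2]
        calc _ ≤ ∫⁻ z in s, ENNReal.ofReal ((1 - t) ^ finrank ℝ E)⁻¹ *
              ∫⁻ x in s, g x ∂ν ∂ν := by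
              refine setLIntegral_mono' hm fun z hz => ?_
              exact setLIntegral_comp_affine_le ν ht1 (t • z)
                (fun x hx => hc hx hz ht1.le ht.1.le (by ring)) g
          _ = ENNReal.ofReal ((1 - t) ^ finrank ℝ E)⁻¹ * ν s * ∫⁻ x in s, g x ∂ν := by
              rw [setLIntegral_const]; ring
          _ ≤ _ := by
              have hl2 : 0 < 1 - l := by linarith
              have := ht.2.le
              gcongr
    _ = _ := by
        rw [setLIntegral_const, Real.volume_Ioo, sub_zero, ENNReal.ofReal_mul hl.le]
        ring

theorem ae_segment_differentiableAt {s : Set E} (hs : IsOpen s) (hc : Convex ℝ s) {f : E → ℝ}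
    (hf : LocallyLipschitzOn s f) {l : ℝ} (hl : 0 < l) (hl1 : l < 1) :
    ∀ᵐ x ∂(ν.restrict s), ∀ᵐ z ∂(ν.restrict s), ∀ᵐ t ∂(volume.restrict (Ioo 0 l)),
      DifferentiableAt ℝ f ((1 - t) • x + t • z) := by
  have hd := hf.ae_differentiableAt ν hs
  set B := toMeasurable ν {x | ¬(x ∈ s → DifferentiableAt ℝ f x)} with hB
  have hB0 : ν B = 0 := by rw [hB, measure_toMeasurable]; exact hd
  have hBm : MeasurableSet B := measurableSet_toMeasurable _ _
  have hg : Measurable (B.indicator (1 : E → ℝ≥0∞)) := measurable_one.indicator hBm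
  have h := lintegral_segments_le ν hc hs.measurableSet hl hl1 hg
  have h0 : ∫⁻ x in s, B.indicator (1 : E → ℝ≥0∞) x ∂ν = 0 := by
    rw [lintegral_indicator_one hBm]
    exact Measure.absolutelyContinuous_of_le Measure.restrict_le_self hB0
  rw [h0, mul_zero, nonpos_iff_eq_zero] at h
  have hm2 : Measurable (fun q : E × E => ∫⁻ t in Ioo 0 l,
      B.indicator (1 : E → ℝ≥0∞) ((1 - t) • q.1 + t • q.2)) :=
    Measurable.lintegral_prod_right' (ν := volume.restrict (Ioo 0 l))
      (f := fun r : (E × E) × ℝ => B.indicator (1 : E → ℝ≥0∞) ((1 - r.2) • r.1.1 + r.2 • r.1.2))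
      (hg.comp (by fun_prop))
  have h1 := (lintegral_eq_zero_iff (hm2.lintegral_prod_right' (ν := ν.restrict s))).1 h
  filter_upwards [h1, ae_restrict_mem hs.measurableSet] with x hx hxs
  have h2 := (lintegral_eq_zero_iff (hm2.comp measurable_prodMk_left)).1 hx
  filter_upwards [h2, ae_restrict_mem hs.measurableSet] with z hz hzs
  have h3 := (lintegral_eq_zero_iff (hg.comp (by fun_prop))).1 hz
  filter_upwards [h3, ae_restrict_mem measurableSet_Ioo] with t ht htl
  have hnB : (1 - t) • x + t • z ∉ B := by
    intro hmem
    simp [indicator_of_mem hmem] at ht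
  by_contra hnd
  exact hnB (subset_toMeasurable _ _ fun hh =>
    hnd (hh (hc hxs hzs (by linarith [htl.2]) htl.1.le (by ring))))

/-- Comparison of a function with its value at a point of the segment towards an arbitrary other
point, integrated over all pairs of points of a convex set. -/
theorem lintegral_enorm_sub_rpow_le {p : ℝ} (hp : 1 < p) {s : Set E} (hs : IsOpen s)
    (hc : Convex ℝ s) {f : E → ℝ} (hf : LocallyLipschitzOn s f) {l : ℝ} (hl : 0 < l)
    (hl1 : l < 1) {D : ℝ} (hD : 0 ≤ D) (hdiam : ∀ x ∈ s, ∀ z ∈ s, ‖z - x‖ ≤ D) :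
    ∫⁻ x in s, ∫⁻ z in s, ‖f x - f ((1 - l) • x + l • z)‖ₑ ^ p ∂ν ∂ν ≤
      ENNReal.ofReal ((l * D) ^ p * ((1 - l) ^ finrank ℝ E)⁻¹) * ν s *
        ∫⁻ x in s, ‖fderiv ℝ f x‖ₑ ^ p ∂ν := by
  have hm := hs.measurableSet
  have hp0 : 0 ≤ p := by linarith
  have hg : Measurable fun x => ‖fderiv ℝ f x‖ₑ ^ p :=
    (measurable_fderiv ℝ f).enorm.pow_const _
  calc _ ≤ ∫⁻ x in s, ∫⁻ z in s, ENNReal.ofReal (l ^ (p - 1) * D ^ p) *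
        (∫⁻ t in Ioo 0 l, ‖fderiv ℝ f ((1 - t) • x + t • z)‖ₑ ^ p) ∂ν ∂ν := by
        refine lintegral_mono_ae ?_
        filter_upwards [ae_segment_differentiableAt ν hs hc hf hl hl1, ae_restrict_mem hm]
          with x hx hxs
        refine lintegral_mono_ae ?_
        filter_upwards [hx, ae_restrict_mem hm] with z hz hzs
        refine (enorm_sub_rpow_le_lintegral_fderiv hp hc hf hxs hzs hl hl1.le hz).trans ?_
        rw [ENNReal.ofReal_mul (by positivity), ENNReal.ofReal_rpow_of_pos hl,
          ← ENNReal.ofReal_rpow_of_nonneg hD hp0]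
        gcongr
        rw [← ofReal_norm]
        exact ENNReal.ofReal_le_ofReal (hdiam x hxs z hzs)
    _ = ENNReal.ofReal (l ^ (p - 1) * D ^ p) * ∫⁻ x in s, ∫⁻ z in s,
        (∫⁻ t in Ioo 0 l, ‖fderiv ℝ f ((1 - t) • x + t • z)‖ₑ ^ p) ∂ν ∂ν := by
        simp_rw [lintegral_const_mul' _ _ ENNReal.ofReal_ne_top]
    _ ≤ ENNReal.ofReal (l ^ (p - 1) * D ^ p) *
        (ENNReal.ofReal (l * ((1 - l) ^ finrank ℝ E)⁻¹) * ν s *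
          ∫⁻ x in s, ‖fderiv ℝ f x‖ₑ ^ p ∂ν) := by
        gcongr
        exact lintegral_segments_le ν hc hm hl hl1 hg
    _ = _ := by
        rw [← mul_assoc, ← mul_assoc, ← ENNReal.ofReal_mul (by positivity)]
        congr 3
        rw [Real.mul_rpow hl.le hD]
        nth_rewrite 3 [← sub_add_cancel p 1]
        rw [Real.rpow_add_one hl.ne']
        ring

/-- A Faber-Krahn inequality: a locally Lipschitz function on a convex set whose support has small
measure is controlled in `L^p` by its gradient. -/
theorem lintegral_enorm_rpow_le_of_small_support {p : ℝ} (hp : 1 < p) {s : Set E} (hs : IsOpen s)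
    (hc : Convex ℝ s) (hne : s.Nonempty) (hfin : ν s ≠ ∞) {f : E → ℝ}
    (hf : LocallyLipschitzOn s f) {l : ℝ}
    (hl : 0 < l) (hl1 : l ≤ 1 / 2) {D : ℝ} (hD : 0 ≤ D) (hdiam : ∀ x ∈ s, ∀ z ∈ s, ‖z - x‖ ≤ D)
    (hsupp : 2 * ν {x ∈ s | f x ≠ 0} ≤ ENNReal.ofReal (l ^ finrank ℝ E) * ν s) :
    ∫⁻ x in s, ‖f x‖ₑ ^ p ∂ν ≤
      ENNReal.ofReal (2 ^ (finrank ℝ E + 1) * (l * D) ^ p) *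
        ∫⁻ x in s, ‖fderiv ℝ f x‖ₑ ^ p ∂ν := by
  have hm := hs.measurableSet
  have hpos : ν s ≠ 0 := (hs.measure_pos ν hne).ne'
  have hp0 : 0 < p := by linarith
  have hhalf (x : E) (hx : x ∈ s) :
      ν s / 2 ≤ ν {z ∈ s | f ((1 - l) • x + l • z) = 0} := by
    have h1 : ν ((fun z => l • z + (1 - l) • x) ⁻¹' {y ∈ s | f y ≠ 0}) ≤ ν s / 2 := by
      rw [measure_preimage_affine ν hl, ENNReal.le_div_iff_mul_le (by simp) (by simp), mul_assoc,
        mul_comm _ (2 : ℝ≥0∞)]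
      refine (mul_le_mul_right hsupp _).trans ?_
      rw [← mul_assoc, ← ENNReal.ofReal_mul (by positivity),
        inv_mul_cancel₀ (by positivity), ENNReal.ofReal_one, one_mul]
    have h2 : s ⊆ {z ∈ s | f ((1 - l) • x + l • z) = 0} ∪
        ((fun z => l • z + (1 - l) • x) ⁻¹' {y ∈ s | f y ≠ 0}) := by
      intro z hz
      by_cases h0 : f ((1 - l) • x + l • z) = 0
      · exact Or.inl ⟨hz, h0⟩
      · refine Or.inr ?_
        rw [mem_preimage, add_comm]
        exact ⟨hc hx hz (by linarith) hl.le (by ring), h0⟩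
    have h3 := (measure_mono h2).trans ((measure_union_le _ _).trans (add_le_add_right h1 _))
    have h4 : ν s / 2 ≠ ∞ := by finiteness
    exact (ENNReal.add_le_add_iff_right h4).1 ((ENNReal.add_halves (ν s)).trans_le h3)
  have hT (x : E) (hx : x ∈ s) : MeasurableSet {z ∈ s | f ((1 - l) • x + l • z) = 0} := by
    have hcont : ContinuousOn (fun z => f ((1 - l) • x + l • z)) s :=
      hf.continuousOn.comp (by fun_prop) fun z hz => hc hx hz (by linarith) hl.le (by ring)
    have ho := hcont.isOpen_inter_preimage hs (isOpen_compl_singleton (x := (0 : ℝ)))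
    convert hm.diff ho.measurableSet using 1
    ext z
    simp only [mem_ofPred_eq, Set.mem_sdiff, mem_inter_iff, mem_preimage, mem_compl_iff,
      mem_singleton_iff]
    tauto
  have hlow : ∫⁻ x in s, ‖f x‖ₑ ^ p * (ν s / 2) ∂ν ≤
      ∫⁻ x in s, ∫⁻ z in s, ‖f x - f ((1 - l) • x + l • z)‖ₑ ^ p ∂ν ∂ν := by
    refine setLIntegral_mono' hm fun x hx => ?_
    calc _ ≤ ‖f x‖ₑ ^ p * ν {z ∈ s | f ((1 - l) • x + l • z) = 0} := by
          gcongr; exact hhalf x hx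
      _ = ∫⁻ z in {z ∈ s | f ((1 - l) • x + l • z) = 0}, ‖f x‖ₑ ^ p ∂ν := by
          rw [setLIntegral_const]
      _ ≤ ∫⁻ z in {z ∈ s | f ((1 - l) • x + l • z) = 0},
            ‖f x - f ((1 - l) • x + l • z)‖ₑ ^ p ∂ν := by
          refine setLIntegral_mono' (hT x hx) fun z hz => ?_
          rw [hz.2, sub_zero]
      _ ≤ _ := lintegral_mono_set fun z hz => hz.1
  have hup := lintegral_enorm_sub_rpow_le ν hp hs hc hf hl (by linarith) hD hdiam
  have h := hlow.trans hup
  rw [lintegral_mul_const' _ _ (by finiteness), ← mul_div_assoc,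
    ENNReal.div_le_iff (by simp) (by simp)] at h
  have h1l : 0 < 1 - l := by linarith
  have hcoef : (l * D) ^ p * ((1 - l) ^ finrank ℝ E)⁻¹ * 2 ≤
      2 ^ (finrank ℝ E + 1) * (l * D) ^ p := by
    have : ((1 - l) ^ finrank ℝ E)⁻¹ ≤ 2 ^ finrank ℝ E := by
      rw [← inv_pow]
      gcongr
      rw [inv_le_comm₀ h1l (by norm_num)]
      linarith
    calc _ ≤ (l * D) ^ p * 2 ^ finrank ℝ E * 2 := by gcongr
      _ = _ := by ring
  refine (ENNReal.mul_le_mul_iff_left hpos hfin).1 (h.trans ?_)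
  calc _ = ENNReal.ofReal ((l * D) ^ p * ((1 - l) ^ finrank ℝ E)⁻¹ * 2) *
        (∫⁻ x in s, ‖fderiv ℝ f x‖ₑ ^ p ∂ν) * ν s := by
        rw [ENNReal.ofReal_mul (q := 2) (by positivity), ENNReal.ofReal_ofNat]
        ring
    _ ≤ _ := by gcongr

/-- A Poincaré inequality on convex sets, in terms of pairs of points. -/
theorem lintegral_enorm_sub_rpow_le_fderiv {p : ℝ} (hp : 1 < p) {s : Set E} (hs : IsOpen s)
    (hc : Convex ℝ s) {f : E → ℝ} (hf : LocallyLipschitzOn s f)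
    {D : ℝ} (hD : 0 ≤ D) (hdiam : ∀ x ∈ s, ∀ z ∈ s, ‖z - x‖ ≤ D) :
    ∫⁻ x in s, ∫⁻ z in s, ‖f x - f z‖ₑ ^ p ∂ν ∂ν ≤
      ENNReal.ofReal (2 ^ finrank ℝ E * D ^ p) * ν s * ∫⁻ x in s, ‖fderiv ℝ f x‖ₑ ^ p ∂ν := by
  have hm := hs.measurableSet
  set g : E → ℝ := s.indicator f with hg
  have hgf {x : E} (hx : x ∈ s) : g x = f x := indicator_of_mem hx f
  have hgm : Measurable g := by
    classical
    rw [hg, ← piecewise_eq_indicator]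
    exact hf.continuousOn.measurable_piecewise continuousOn_const hm
  set F : E → E → ℝ≥0∞ := fun x z => ‖g x - g ((1 / 2 : ℝ) • x + (1 / 2 : ℝ) • z)‖ₑ ^ p with hF
  have hFm : Measurable (Function.uncurry F) := by
    refine Measurable.pow_const (Measurable.enorm ?_) p
    exact (hgm.comp measurable_fst).sub (hgm.comp (by fun_prop))
  have hFm' : Measurable (Function.uncurry fun z x => F x z) := hFm.comp measurable_swap
  have hFint : ∫⁻ x in s, ∫⁻ z in s, F x z ∂ν ∂ν ≤
      ENNReal.ofReal ((1 / 2 * D) ^ p * 2 ^ finrank ℝ E) * ν s *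
        ∫⁻ x in s, ‖fderiv ℝ f x‖ₑ ^ p ∂ν := by
    have h := lintegral_enorm_sub_rpow_le ν hp hs hc hf (l := 1 / 2) (by norm_num) (by norm_num)
      hD hdiam
    norm_num only at h
    rw [← inv_pow] at h
    norm_num only at h
    refine le_trans (le_of_eq ?_) h
    refine setLIntegral_congr_fun hm fun x hx => setLIntegral_congr_fun hm fun z hz => ?_
    simp only [hF]
    rw [hgf hx, hgf (hc hx hz (by norm_num) (by norm_num) (by norm_num))]
  have hpt (x z : E) (hx : x ∈ s) (hz : z ∈ s) :
      ‖f x - f z‖ₑ ^ p ≤ 2 ^ (p - 1) * (F x z + F z x) := by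
    have heq : f x - f z = (g x - g ((1 / 2 : ℝ) • x + (1 / 2 : ℝ) • z)) -
        (g z - g ((1 / 2 : ℝ) • z + (1 / 2 : ℝ) • x)) := by
      rw [add_comm ((1 / 2 : ℝ) • z), hgf hx, hgf hz]; ring
    refine le_trans ?_ (ENNReal.rpow_add_le_mul_rpow_add_rpow _ _ hp.le)
    rw [heq]
    gcongr
    exact enorm_sub_le
  calc _ ≤ ∫⁻ x in s, ∫⁻ z in s, 2 ^ (p - 1) * (F x z + F z x) ∂ν ∂ν :=
        setLIntegral_mono' hm fun x hx => setLIntegral_mono' hm fun z hz => hpt x z hx hz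
    _ = 2 ^ (p - 1) * (∫⁻ x in s, ∫⁻ z in s, F x z ∂ν ∂ν + ∫⁻ x in s, ∫⁻ z in s, F z x ∂ν ∂ν) := by
        have h2 : (2 : ℝ≥0∞) ^ (p - 1) ≠ ∞ := ENNReal.rpow_ne_top_of_ne_zero (by simp) (by simp)
        simp_rw [lintegral_const_mul' _ _ h2]
        rw [← lintegral_add_left (hFm.lintegral_prod_right (ν := ν.restrict s))]
        congr 1
        refine lintegral_congr fun x => ?_
        exact lintegral_add_left (hFm.comp measurable_prodMk_left) _
    _ = 2 ^ (p - 1) * (2 * ∫⁻ x in s, ∫⁻ z in s, F x z ∂ν ∂ν) := by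
        rw [lintegral_lintegral_swap (f := fun x z => F z x) hFm'.aemeasurable, two_mul]
    _ ≤ 2 ^ (p - 1) * (2 * (ENNReal.ofReal ((1 / 2 * D) ^ p * 2 ^ finrank ℝ E) * ν s *
        ∫⁻ x in s, ‖fderiv ℝ f x‖ₑ ^ p ∂ν)) := by gcongr
    _ = _ := by
        have h2 : (2 : ℝ≥0∞) ^ (p - 1) * 2 = ENNReal.ofReal (2 ^ p) := by
          rw [← ENNReal.ofReal_rpow_of_pos (by norm_num), ENNReal.ofReal_ofNat]
          nth_rewrite 2 [← ENNReal.rpow_one 2]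
          rw [← ENNReal.rpow_add _ _ (by simp) (by simp), sub_add_cancel]
        rw [← mul_assoc, h2, ← mul_assoc, ← mul_assoc, ← ENNReal.ofReal_mul (by positivity)]
        congr 3
        rw [Real.mul_rpow (by norm_num) hD, one_div, Real.inv_rpow (by norm_num)]
        have : (2 : ℝ) ^ p ≠ 0 := by positivity
        field_simp

end SegmentEstimates

section SignedPower

/-- The derivative of `|x| ^ p / p`. -/
noncomputable def signedRpow (p x : ℝ) : ℝ := |x| ^ (p - 2) * x

theorem signedRpow_mul_self {p : ℝ} (hp : 1 < p) (x : ℝ) : signedRpow p x * x = |x| ^ p := by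
  rcases eq_or_ne x 0 with rfl | hx
  · simp [signedRpow, Real.zero_rpow (by linarith : p ≠ 0)]
  · have h : |x| ^ p = |x| ^ (p - 2) * |x| ^ (2 : ℝ) := by
      rw [← Real.rpow_add (abs_pos.2 hx), sub_add_cancel]
    rw [h, Real.rpow_two, sq_abs, signedRpow]
    ring

theorem abs_signedRpow {p : ℝ} (hp : 1 < p) (x : ℝ) : |signedRpow p x| = |x| ^ (p - 1) := by
  rcases eq_or_ne x 0 with rfl | hx
  · simp [signedRpow, Real.zero_rpow (by linarith : p - 1 ≠ 0)]
  · rw [signedRpow, abs_mul, abs_of_nonneg (Real.rpow_nonneg (abs_nonneg x) _),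
      ← Real.rpow_add_one (abs_pos.2 hx).ne']
    ring_nf

theorem signedRpow_nonneg (p : ℝ) {x : ℝ} (hx : 0 ≤ x) : 0 ≤ signedRpow p x :=
  mul_nonneg (Real.rpow_nonneg (abs_nonneg x) _) hx

theorem signedRpow_nonpos (p : ℝ) {x : ℝ} (hx : x ≤ 0) : signedRpow p x ≤ 0 :=
  mul_nonpos_of_nonneg_of_nonpos (Real.rpow_nonneg (abs_nonneg x) _) hx

theorem signedRpow_neg (p x : ℝ) : signedRpow p (-x) = -signedRpow p x := by
  simp [signedRpow]

theorem signedRpow_of_nonneg {p : ℝ} (hp : 1 < p) {x : ℝ} (hx : 0 ≤ x) :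
    signedRpow p x = x ^ (p - 1) := by
  rw [← abs_of_nonneg (signedRpow_nonneg p hx), abs_signedRpow hp, abs_of_nonneg hx]

theorem continuous_signedRpow {p : ℝ} (hp : 1 < p) : Continuous (signedRpow p) := by
  have h : signedRpow p = fun x => (max x 0) ^ (p - 1) - (max (-x) 0) ^ (p - 1) := by
    funext x
    have h0 : (0 : ℝ) ^ (p - 1) = 0 := Real.zero_rpow (by linarith)
    rcases le_total 0 x with hx | hx
    · rw [max_eq_left hx, max_eq_right (by linarith), h0, sub_zero, signedRpow_of_nonneg hp hx]
    · rw [max_eq_right hx, max_eq_left (by linarith), h0, zero_sub,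
        ← signedRpow_of_nonneg hp (by linarith : 0 ≤ -x), signedRpow_neg, neg_neg]
  rw [h]
  have hp1 : 0 ≤ p - 1 := by linarith
  exact ((continuous_id.max continuous_const).rpow_const fun _ => Or.inr hp1).sub
    ((continuous_neg.max continuous_const).rpow_const fun _ => Or.inr hp1)

theorem abs_mul_abs_rpow_le {p : ℝ} (hp : 1 < p) (a b : ℝ) :
    |a| ^ (p - 1) * |b| ≤ (p - 1) / p * |a| ^ p + |b| ^ p / p := by
  have hpq := (Real.HolderConjugate.conjExponent hp).symm
  have h := Real.young_inequality_of_nonneg (Real.rpow_nonneg (abs_nonneg a) (p - 1))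
    (abs_nonneg b) hpq
  rw [← Real.rpow_mul (abs_nonneg a)] at h
  have hp1 : p - 1 ≠ 0 := by linarith
  have hp0 : p ≠ 0 := by linarith
  have h1 : (p - 1) * p.conjExponent = p := by rw [Real.conjExponent]; field_simp
  rw [h1, Real.conjExponent] at h
  refine h.trans (le_of_eq ?_)
  field_simp

/-- The tangent inequality for the convex function `|x| ^ p`. -/
theorem abs_rpow_sub_le {p : ℝ} (hp : 1 < p) (a b : ℝ) :
    |a| ^ p - p * (signedRpow p a * b) ≤ |a - b| ^ p := by
  have h := abs_mul_abs_rpow_le hp a (a - b)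
  have h1 : signedRpow p a * (a - b) ≤ |a| ^ (p - 1) * |a - b| := by
    rw [← abs_signedRpow hp, ← abs_mul]
    exact le_abs_self _
  rw [mul_sub, signedRpow_mul_self hp] at h1
  have hp0 : 0 < p := by linarith
  have h2 := mul_le_mul_of_nonneg_left (h1.trans h) hp0.le
  have h3 : p * ((p - 1) / p * |a| ^ p + |a - b| ^ p / p) = (p - 1) * |a| ^ p + |a - b| ^ p := by
    field_simp
  rw [h3] at h2
  linarith

theorem abs_add_rpow_le {p : ℝ} (hp : 1 < p) (a b : ℝ) :
    |a + b| ^ p ≤ 2 ^ p * (|a| ^ p + |b| ^ p) := by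
  have hp0 : 0 ≤ p := by linarith
  have h : |a + b| ≤ 2 * max |a| |b| := by
    have := abs_add_le a b
    linarith [le_max_left |a| |b|, le_max_right |a| |b|]
  calc _ ≤ (2 * max |a| |b|) ^ p := by gcongr
    _ = 2 ^ p * max |a| |b| ^ p := Real.mul_rpow (by norm_num) (by positivity)
    _ ≤ _ := by
      gcongr
      rcases max_choice |a| |b| with h | h <;> rw [h] <;>
        linarith [Real.rpow_nonneg (abs_nonneg a) p, Real.rpow_nonneg (abs_nonneg b) p]

variable {α : Type*} [MeasurableSpace α] {m : Measure α}

theorem integrable_abs_sub_rpow {p : ℝ} (hp : 1 < p) {f g : α → ℝ}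
    (hfm : AEStronglyMeasurable f m) (hgm : AEStronglyMeasurable g m)
    (hf : Integrable (fun x => |f x| ^ p) m) (hg : Integrable (fun x => |g x| ^ p) m) :
    Integrable (fun x => |f x - g x| ^ p) m := by
  refine ((hf.add hg).const_mul (2 ^ p)).mono' ?_ ?_
  · exact ((continuous_abs.rpow_const fun _ => Or.inr (by linarith)).comp_aestronglyMeasurable
      (hfm.sub hgm))
  · refine Eventually.of_forall fun x => ?_
    rw [Real.norm_of_nonneg (by positivity), sub_eq_add_neg]
    simpa using abs_add_rpow_le hp (f x) (-g x)

theorem integrable_signedRpow_mul {p : ℝ} (hp : 1 < p) {f g : α → ℝ}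
    (hfm : AEStronglyMeasurable f m) (hgm : AEStronglyMeasurable g m)
    (hf : Integrable (fun x => |f x| ^ p) m) (hg : Integrable (fun x => |g x| ^ p) m) :
    Integrable (fun x => signedRpow p (f x) * g x) m := by
  refine ((hf.const_mul ((p - 1) / p)).add (hg.div_const p)).mono' ?_ ?_
  · exact ((continuous_signedRpow hp).comp_aestronglyMeasurable hfm).mul hgm
  · refine Eventually.of_forall fun x => ?_
    rw [Real.norm_eq_abs, abs_mul, abs_signedRpow hp]
    exact abs_mul_abs_rpow_le hp (f x) (g x)

theorem integrable_signedRpow [IsFiniteMeasure m] {p : ℝ} (hp : 1 < p) {f : α → ℝ}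
    (hfm : AEStronglyMeasurable f m) (hf : Integrable (fun x => |f x| ^ p) m) :
    Integrable (fun x => signedRpow p (f x)) m := by
  simpa using integrable_signedRpow_mul hp hfm
    (aestronglyMeasurable_const (b := (1 : ℝ))) hf (integrable_const _)

/-- A lower bound for the `p`-norm of a perturbation of `f`, up to constants. -/
theorem integral_abs_sub_sub_const_rpow_ge [IsFiniteMeasure m] {p : ℝ} (hp : 1 < p) {f g : α → ℝ}
    (hfm : AEStronglyMeasurable f m) (hgm : AEStronglyMeasurable g m)
    (hf : Integrable (fun x => |f x| ^ p) m) (hg : Integrable (fun x => |g x| ^ p) m) (c : ℝ) :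
    ∫ x, |f x| ^ p ∂m - p * ∫ x, signedRpow p (f x) * g x ∂m -
      p * c * ∫ x, signedRpow p (f x) ∂m ≤ ∫ x, |f x - g x - c| ^ p ∂m := by
  have h1 := integrable_signedRpow_mul hp hfm hgm hf hg
  have h2 := integrable_signedRpow hp hfm hf
  have h3 := integrable_abs_sub_rpow hp (hfm.sub hgm) (aestronglyMeasurable_const (b := c))
    (integrable_abs_sub_rpow hp hfm hgm hf hg) (integrable_const _)
  have h4 : Integrable (fun x => |f x| ^ p - p * (signedRpow p (f x) * g x)) m :=
    hf.sub (h1.const_mul p)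
  rw [← integral_const_mul, ← integral_const_mul, ← integral_sub hf (h1.const_mul p),
    ← integral_sub h4 (h2.const_mul (p * c))]
  refine integral_mono (h4.sub (h2.const_mul (p * c))) h3 fun x => ?_
  have := abs_rpow_sub_le hp (f x) (g x + c)
  rw [← sub_sub] at this
  refine le_trans (le_of_eq ?_) this
  ring

theorem integral_abs_rpow_le_sub_const [IsFiniteMeasure m] {p : ℝ} (hp : 1 < p) {f : α → ℝ}
    (hfm : AEStronglyMeasurable f m) (hf : Integrable (fun x => |f x| ^ p) m)
    (h0 : ∫ x, signedRpow p (f x) ∂m = 0) (c : ℝ) :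
    ∫ x, |f x| ^ p ∂m ≤ ∫ x, |f x - c| ^ p ∂m := by
  have h := integral_abs_sub_sub_const_rpow_ge hp hfm (aestronglyMeasurable_const (b := (0 : ℝ))) hf
    (by simp [Real.zero_rpow (by linarith : p ≠ 0)]) c
  simpa [h0] using h

theorem exists_integral_signedRpow_eq_zero [IsFiniteMeasure m] {p : ℝ} (hp : 1 < p) {f : α → ℝ}
    (hfm : AEStronglyMeasurable f m) {M : ℝ} (hM : ∀ᵐ x ∂m, |f x| ≤ M) :
    ∃ c, ∫ x, signedRpow p (f x - c) ∂m = 0 := by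
  have hcont : ContinuousOn (fun c => ∫ x, signedRpow p (f x - c) ∂m) (Icc (-|M|) |M|) := by
    refine continuousOn_of_dominated (bound := fun _ => (|M| + |M|) ^ (p - 1)) ?_ ?_
      (integrable_const _) ?_
    · exact fun c _ => (continuous_signedRpow hp).comp_aestronglyMeasurable
        (hfm.sub aestronglyMeasurable_const)
    · intro c hc
      filter_upwards [hM] with x hx
      rw [Real.norm_eq_abs, abs_signedRpow hp]
      have := abs_sub (f x) c
      have := abs_le.2 hc
      have := le_abs_self M
      refine Real.rpow_le_rpow (abs_nonneg _) (by linarith) (by linarith)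
    · exact Eventually.of_forall fun x =>
        ((continuous_signedRpow hp).comp (continuous_const.sub continuous_id)).continuousOn
  have h1 : ∫ x, signedRpow p (f x - |M|) ∂m ≤ 0 := by
    refine integral_nonpos_of_ae ?_
    filter_upwards [hM] with x hx
    exact signedRpow_nonpos p (by linarith [le_abs_self (f x), le_abs_self M])
  have h2 : 0 ≤ ∫ x, signedRpow p (f x - -|M|) ∂m := by
    refine integral_nonneg_of_ae ?_
    filter_upwards [hM] with x hx
    exact signedRpow_nonneg p (by linarith [neg_abs_le (f x), le_abs_self M])
  obtain ⟨c, -, hc⟩ := intermediate_value_Icc' (by linarith [abs_nonneg M]) hcont ⟨h1, h2⟩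
  exact ⟨c, hc⟩

end SignedPower

section Variational

variable {N : ℕ} {Ω : Set (EuclideanSpace ℝ (Fin N))} {p : ℝ}

theorem muP_one_nonneg (p : ℝ) (Ω : Set (EuclideanSpace ℝ (Fin N))) :
    0 ≤ muP p Ω (fun _ => 1) := by
  refine Real.sInf_nonneg ?_
  rintro r ⟨u, K, -, -, -, rfl⟩
  exact div_nonneg (integral_nonneg fun x => by positivity) (integral_nonneg fun x => by positivity)

theorem muP_one_mul_le_of_lipschitzWith (hp : 1 < p) {w : EuclideanSpace ℝ (Fin N) → ℝ} {K : NNReal}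
    (hw : LipschitzWith K w) (h0 : ∫ x in Ω, signedRpow p (w x) = 0) :
    muP p Ω (fun _ => 1) * ∫ x in Ω, |w x| ^ p ≤ ∫ x in Ω, ‖fderiv ℝ w x‖ ^ p := by
  have hnn : 0 ≤ ∫ x in Ω, ‖fderiv ℝ w x‖ ^ p := integral_nonneg fun x => by positivity
  have hnn' : 0 ≤ ∫ x in Ω, |w x| ^ p := integral_nonneg fun x => by positivity
  rcases hnn'.eq_or_lt with hz | hpos
  · rwa [← hz, mul_zero]
  by_cases hae : ∀ᵐ x ∂(volume.restrict Ω), w x = 0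
  · exact absurd (integral_eq_zero_of_ae
      (hae.mono fun x hx => by simp [hx, (by linarith : p ≠ 0)])) hpos.ne'
  · rw [← le_div_iff₀ hpos]
    refine csInf_le ⟨0, ?_⟩ ⟨w, K, hw, hae, by simpa [signedRpow] using h0, by simp⟩
    rintro r ⟨u, K, -, -, -, rfl⟩
    exact div_nonneg (integral_nonneg fun x => by positivity)
      (integral_nonneg fun x => by positivity)

theorem image_affine_closure_subset {E : Type*} [NormedAddCommGroup E] [NormedSpace ℝ E]
    {s : Set E} (hs : IsOpen s) (hc : Convex ℝ s) {x₀ : E} (hx₀ : x₀ ∈ s) {t : ℝ}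
    (ht : 0 ≤ t) (ht1 : t < 1) :
    (fun x => t • x + (1 - t) • x₀) '' closure s ⊆ s := by
  rintro _ ⟨x, hx, rfl⟩
  have h := hc.combo_interior_closure_mem_interior (hs.interior_eq.symm ▸ hx₀) hx
    (by linarith : 0 < 1 - t) ht (by ring)
  rw [hs.interior_eq] at h
  simpa only [add_comm] using h

theorem isOpen_image_affine {E : Type*} [NormedAddCommGroup E] [NormedSpace ℝ E]
    {s : Set E} (hs : IsOpen s) {t : ℝ} (ht : t ≠ 0) (b : E) :
    IsOpen ((fun x => t • x + b) '' s) := by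
  have h : IsOpenMap (fun x : E => t • x + b) :=
    (Homeomorph.addRight b).isOpenMap.comp (isOpenMap_smul₀ ht)
  exact h s hs

theorem preimage_image_affine {E : Type*} [NormedAddCommGroup E] [NormedSpace ℝ E]
    (s : Set E) {t : ℝ} (ht : t ≠ 0) (b : E) :
    (fun x => t • x + b) ⁻¹' ((fun x => t • x + b) '' s) = s :=
  preimage_image_eq _ fun _ _ h => smul_right_injective E ht (add_right_cancel h)

theorem norm_fderiv_comp_affine {E : Type*} [NormedAddCommGroup E] [NormedSpace ℝ E]
    (f : E → ℝ) {t : ℝ} (ht : 0 < t) (b x : E) :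
    ‖fderiv ℝ (fun y => f (t • y + b)) x‖ = t * ‖fderiv ℝ f (t • x + b)‖ := by
  rw [fderiv_comp_smul (f := fun y => f (y + b)) t]
  simp [norm_smul, abs_of_pos ht, fderiv_comp_add_right]

/-- The scaled Poincaré–Wirtinger inequality for locally Lipschitz functions on homothetic
copies that are relatively compact in the domain. -/
theorem exists_muP_one_mul_le_of_homothety (hp : 1 < p) (hs : IsOpen Ω) (hc : Convex ℝ Ω)
    (hb : Bornology.IsBounded Ω) {v : EuclideanSpace ℝ (Fin N) → ℝ} (hv : LocallyLipschitzOn Ω v)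
    {x₀ : EuclideanSpace ℝ (Fin N)} (hx₀ : x₀ ∈ Ω) {t : ℝ} (ht : 0 < t) (ht1 : t < 1) :
    ∃ c, ∫ x in (fun x => t • x + (1 - t) • x₀) '' Ω, signedRpow p (v x - c) = 0 ∧
      muP p Ω (fun _ => 1) * ∫ x in (fun x => t • x + (1 - t) • x₀) '' Ω, |v x - c| ^ p ≤
        t ^ p * ∫ x in (fun x => t • x + (1 - t) • x₀) '' Ω, ‖fderiv ℝ v x‖ ^ p := by
  set b := (1 - t) • x₀
  set T : EuclideanSpace ℝ (Fin N) → EuclideanSpace ℝ (Fin N) := fun x => t • x + b with hT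
  have hsub : T '' closure Ω ⊆ Ω := image_affine_closure_subset hs hc hx₀ ht.le ht1
  have hcpt : IsCompact (T '' closure Ω) :=
    hb.isCompact_closure.image (by fun_prop)
  obtain ⟨K, hK⟩ := (hv.mono hsub).exists_lipschitzOnWith_of_compact hcpt
  obtain ⟨w, hw, hvw⟩ := hK.extend_real
  have hTlip : LipschitzWith t.toNNReal T := by
    refine LipschitzWith.of_dist_le_mul fun x y => ?_
    simp [hT, dist_eq_norm, ← smul_sub, norm_smul, abs_of_pos ht, Real.coe_toNNReal t ht.le]
  have hopen : IsOpen (T '' Ω) := isOpen_image_affine hs ht.ne' b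
  have heq : EqOn v w (T '' Ω) := hvw.mono (image_mono subset_closure)
  have hwT := hw.comp hTlip
  have : IsFiniteMeasure (volume.restrict Ω) := ⟨by simpa using hb.measure_lt_top⟩
  obtain ⟨M, hM⟩ := hb.isCompact_closure.exists_bound_of_continuousOn hwT.continuous.continuousOn
  obtain ⟨c, hc0⟩ := exists_integral_signedRpow_eq_zero (m := volume.restrict Ω) hp
    hwT.continuous.aestronglyMeasurable
    (ae_restrict_of_forall_mem hs.measurableSet fun x hx => hM x (subset_closure hx))
  have hle := muP_one_mul_le_of_lipschitzWith hp (hwT.sub (LipschitzWith.const c)) hc0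
  have hpre : (fun x => t • x + b) ⁻¹' (T '' Ω) = Ω := preimage_image_affine Ω ht.ne' b
  have hcv : ∀ f g : EuclideanSpace ℝ (Fin N) → ℝ, (∀ x ∈ Ω, g x = f (T x)) →
      ∫ x in T '' Ω, f x = t ^ N * ∫ x in Ω, g x := by
    intro f g hfg
    have h := setIntegral_comp_affine volume ht b (T '' Ω) f
    rw [hpre, finrank_euclideanSpace_fin] at h
    rw [setIntegral_congr_fun hs.measurableSet hfg]
    rw [show (fun x => f (T x)) = fun x => f (t • x + b) from rfl, h]
    field_simp
  refine ⟨c, ?_, ?_⟩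
  · rw [hcv _ (fun x => signedRpow p ((w ∘ T) x - c)), hc0, mul_zero]
    intro x hx
    simp [heq (mem_image_of_mem T hx)]
  · rw [hcv _ (fun x => |(w ∘ T) x - c| ^ p),
      hcv _ (fun x => t⁻¹ ^ p * ‖fderiv ℝ (fun y => (w ∘ T) y - c) x‖ ^ p), integral_const_mul]
    · calc _ = t ^ N * (muP p Ω (fun _ => 1) * ∫ x in Ω, |(w ∘ T) x - c| ^ p) := by ring
        _ ≤ t ^ N * ∫ x in Ω, ‖fderiv ℝ (fun y => (w ∘ T) y - c) x‖ ^ p := by gcongr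
        _ = (t ^ p * t⁻¹ ^ p) * (t ^ N * ∫ x in Ω, ‖fderiv ℝ (fun y => (w ∘ T) y - c) x‖ ^ p) := by
          rw [← Real.mul_rpow ht.le (by positivity), mul_inv_cancel₀ ht.ne', Real.one_rpow, one_mul]
        _ = _ := by ring
    · intro x hx
      have h1 : w =ᶠ[𝓝 (T x)] v :=
        (heq.eventuallyEq_of_mem (hopen.mem_nhds (mem_image_of_mem T hx))).symm
      have h2 : ‖fderiv ℝ (fun y => (w ∘ T) y - c) x‖ = t * ‖fderiv ℝ v (T x)‖ := by
        rw [fderiv_sub_const, ← h1.fderiv_eq]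
        exact norm_fderiv_comp_affine w ht b x
      rw [h2, ← Real.mul_rpow (by positivity) (by positivity), inv_mul_cancel_left₀ ht.ne']
    · intro x hx
      simp [heq (mem_image_of_mem T hx)]

end Variational

section EulerLagrange

variable {N : ℕ} {Ω : Set (EuclideanSpace ℝ (Fin N))} {p : ℝ}

theorem tendsto_setIntegral_homothety (hs : IsOpen Ω) (hc : Convex ℝ Ω)
    {x₀ : EuclideanSpace ℝ (Fin N)} (hx₀ : x₀ ∈ Ω) {f : EuclideanSpace ℝ (Fin N) → ℝ}
    (hf : IntegrableOn f Ω) :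
    Tendsto (fun t : ℝ => ∫ x in (fun x => t • x + (1 - t) • x₀) '' Ω, f x) (𝓝[<] 1)
      (𝓝 (∫ x in Ω, f x)) := by
  have hIoo : Ioo (0 : ℝ) 1 ∈ 𝓝[<] (1 : ℝ) := Ioo_mem_nhdsLT one_pos
  have hopen : ∀ t ∈ Ioo (0 : ℝ) 1, IsOpen ((fun x => t • x + (1 - t) • x₀) '' Ω) :=
    fun t ht => isOpen_image_affine hs ht.1.ne' _
  have h : Tendsto (fun t : ℝ => ∫ x in Ω, ((fun x => t • x + (1 - t) • x₀) '' Ω).indicator f x)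
      (𝓝[<] 1) (𝓝 (∫ x in Ω, f x)) := by
    refine tendsto_integral_filter_of_dominated_convergence (fun x => ‖f x‖) ?_ ?_ hf.norm ?_
    · filter_upwards [hIoo] with t ht
      exact hf.aestronglyMeasurable.indicator (hopen t ht).measurableSet
    · exact Eventually.of_forall fun t => Eventually.of_forall fun x => norm_indicator_le_norm_self _ _
    · filter_upwards [ae_restrict_mem hs.measurableSet] with x hx
      refine tendsto_const_nhds.congr' ?_
      have hlim : Tendsto (fun t : ℝ => t⁻¹ • (x - (1 - t) • x₀)) (𝓝[<] 1) (𝓝 x) := by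
        have : ContinuousAt (fun t : ℝ => t⁻¹ • (x - (1 - t) • x₀)) 1 := by
          fun_prop (disch := norm_num)
        simpa using this.tendsto.mono_left nhdsWithin_le_nhds
      filter_upwards [hlim.eventually (hs.mem_nhds hx), hIoo] with t ht ht0
      have hmem : x ∈ (fun y => t • y + (1 - t) • x₀) '' Ω :=
        ⟨_, ht, by simp [smul_inv_smul₀ ht0.1.ne']⟩
      exact (indicator_of_mem hmem f).symm
  refine h.congr' ?_
  filter_upwards [hIoo] with t ht
  rw [setIntegral_indicator (hopen t ht).measurableSet, inter_eq_right.2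
    ((image_mono subset_closure).trans (image_affine_closure_subset hs hc hx₀ ht.1.le ht.2))]

theorem abs_rpow_mul_measureReal_le {α : Type*} [MeasurableSpace α] {m : Measure α}
    [IsFiniteMeasure m] (hp : 1 < p) {v : α → ℝ} (hvm : AEStronglyMeasurable v m)
    (hv : Integrable (fun x => |v x| ^ p) m) {c : ℝ} (h0 : ∫ x, signedRpow p (v x - c) ∂m = 0) :
    |c| ^ p * m.real univ ≤ 2 ^ (p + 1) * ∫ x, |v x| ^ p ∂m := by
  have hvc := integrable_abs_sub_rpow hp hvm (aestronglyMeasurable_const (b := c)) hv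
    (integrable_const _)
  have h := integral_abs_rpow_le_sub_const hp (hvm.sub aestronglyMeasurable_const) hvc h0 (-c)
  simp only [Pi.sub_apply, sub_neg_eq_add, sub_add_cancel] at h
  calc _ = ∫ _, |c| ^ p ∂m := by simp [mul_comm]
    _ ≤ ∫ x, 2 ^ p * (|v x| ^ p + |v x - c| ^ p) ∂m := by
      refine integral_mono (integrable_const _) ((hv.add hvc).const_mul _) fun x => ?_
      have := abs_add_rpow_le hp (v x) (-(v x - c))
      rwa [abs_neg, neg_sub, add_sub_cancel] at this
    _ = 2 ^ p * (∫ x, |v x| ^ p ∂m + ∫ x, |v x - c| ^ p ∂m) := by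
      rw [integral_const_mul, integral_add hv hvc]
    _ ≤ 2 ^ p * (∫ x, |v x| ^ p ∂m + ∫ x, |v x| ^ p ∂m) := by gcongr
    _ = _ := by rw [Real.rpow_add_one two_ne_zero]; ring

/-- The variational inequality satisfied by an eigenfunction, tested against a locally Lipschitz
competitor. -/
theorem muP_one_mul_sub_le (hp : 1 < p) (hs : IsOpen Ω) (hc : Convex ℝ Ω)
    (hb : Bornology.IsBounded Ω) (hne : Ω.Nonempty) {u v : EuclideanSpace ℝ (Fin N) → ℝ}
    (hv : LocallyLipschitzOn Ω v) (hvp : IntegrableOn (fun x => |v x| ^ p) Ω)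
    (hvd : IntegrableOn (fun x => ‖fderiv ℝ v x‖ ^ p) Ω) (hu : ContinuousOn u Ω)
    (hup : IntegrableOn (fun x => |u x| ^ p) Ω) (hu0 : ∫ x in Ω, signedRpow p (u x) = 0) :
    muP p Ω (fun _ => 1) *
        ((∫ x in Ω, |u x| ^ p) - p * ∫ x in Ω, signedRpow p (u x) * (u x - v x)) ≤
      ∫ x in Ω, ‖fderiv ℝ v x‖ ^ p := by
  obtain ⟨x₀, hx₀⟩ := hne
  have hfin : IsFiniteMeasure (volume.restrict Ω) := ⟨by simpa using hb.measure_lt_top⟩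
  have hum := hu.aestronglyMeasurable hs.measurableSet (μ := volume)
  have hvm := hv.continuousOn.aestronglyMeasurable hs.measurableSet (μ := volume)
  set W : ℝ → Set (EuclideanSpace ℝ (Fin N)) := fun t => (fun x => t • x + (1 - t) • x₀) '' Ω
  have hIoo : Ioo (0 : ℝ) 1 ∈ 𝓝[<] (1 : ℝ) := Ioo_mem_nhdsLT one_pos
  have hW : ∀ t ∈ Ioo (0 : ℝ) 1, W t ⊆ Ω := fun t ht =>
    (image_mono subset_closure).trans (image_affine_closure_subset hs hc hx₀ ht.1.le ht.2)
  have hex : ∀ t ∈ Ioo (0 : ℝ) 1, ∃ c, ∫ x in W t, signedRpow p (v x - c) = 0 ∧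
      muP p Ω (fun _ => 1) * ∫ x in W t, |v x - c| ^ p ≤
        t ^ p * ∫ x in W t, ‖fderiv ℝ v x‖ ^ p := fun t ht =>
    exists_muP_one_mul_le_of_homothety hp hs hc hb hv hx₀ ht.1 ht.2
  choose! c hc0 hcle using hex
  have hV : 0 < volume.real Ω :=
    ENNReal.toReal_pos (hs.measure_pos _ ⟨x₀, hx₀⟩).ne' hb.measure_lt_top.ne
  have hsr := integrable_signedRpow hp hum hup
  have hsm := integrable_signedRpow_mul hp hum (hum.sub hvm) hup
    (integrable_abs_sub_rpow hp hum hvm hup hvp)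
  have htend : ∀ {f : EuclideanSpace ℝ (Fin N) → ℝ}, IntegrableOn f Ω →
      Tendsto (fun t => ∫ x in W t, f x) (𝓝[<] 1) (𝓝 (∫ x in Ω, f x)) := fun hf =>
    tendsto_setIntegral_homothety hs hc hx₀ hf
  have hvol : ∀ᶠ t in 𝓝[<] (1 : ℝ), volume.real Ω / 2 ≤ volume.real (W t) := by
    have h := htend (f := fun _ => (1 : ℝ)) (integrable_const _)
    simp only [integral_const, measureReal_restrict_apply_univ, smul_eq_mul, mul_one] at h
    exact h.eventually_const_le (half_lt_self hV)
  have hbdd : ∀ᶠ t in 𝓝[<] (1 : ℝ), |c t| ≤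
      (2 ^ (p + 1) * (∫ x in Ω, |v x| ^ p) / (volume.real Ω / 2)) ^ p⁻¹ := by
    filter_upwards [hvol, hIoo] with t ht ht0
    have hres := Measure.restrict_mono_set volume (hW t ht0)
    have : IsFiniteMeasure (volume.restrict (W t)) := isFiniteMeasure_of_le _ hres
    have h := abs_rpow_mul_measureReal_le hp (hvm.mono_measure hres)
      (hvp.mono_set (hW t ht0)) (hc0 t ht0)
    rw [measureReal_restrict_apply_univ] at h
    rw [Real.le_rpow_inv_iff_of_pos (abs_nonneg _) (by positivity) (by linarith),
      le_div_iff₀ (by positivity)]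
    calc _ ≤ |c t| ^ p * volume.real (W t) := by gcongr
      _ ≤ _ := h
      _ ≤ _ := by
        gcongr
        exact Eventually.of_forall fun x => by positivity
  have hcz : Tendsto (fun t => c t * ∫ x in W t, signedRpow p (u x)) (𝓝[<] 1) (𝓝 0) := by
    refine bdd_le_mul_tendsto_zero' _ hbdd ?_
    rw [← hu0]
    exact htend hsr
  have hlim := (((htend hup).sub ((htend hsm).const_mul p)).sub (hcz.const_mul p)).const_mul
    (muP p Ω (fun _ => 1))
  rw [mul_zero, sub_zero] at hlim
  refine le_of_tendsto hlim ?_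
  filter_upwards [hIoo] with t ht0
  have hres := Measure.restrict_mono_set volume (hW t ht0)
  have : IsFiniteMeasure (volume.restrict (W t)) := isFiniteMeasure_of_le _ hres
  have h := integral_abs_sub_sub_const_rpow_ge hp (hum.mono_measure hres)
    ((hum.sub hvm).mono_measure hres) (hup.mono_set (hW t ht0))
    ((integrable_abs_sub_rpow hp hum hvm hup hvp).mono_measure hres) (c t)
  simp only [Pi.sub_apply, sub_sub_cancel] at h
  calc _ ≤ muP p Ω (fun _ => 1) * ∫ x in W t, |v x - c t| ^ p := by
        refine mul_le_mul_of_nonneg_left (le_trans (le_of_eq ?_) h) (muP_one_nonneg p Ω)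
        simp only [Pi.sub_apply, W]
        ring
    _ ≤ t ^ p * ∫ x in W t, ‖fderiv ℝ v x‖ ^ p := hcle t ht0
    _ ≤ 1 * ∫ x in Ω, ‖fderiv ℝ v x‖ ^ p := by
      gcongr
      · exact Real.rpow_le_one ht0.1.le ht0.2.le (by linarith)
      · exact Eventually.of_forall fun x => by positivity
    _ = _ := one_mul _

end EulerLagrange

section Eigenfunction

variable {N : ℕ} {Ω : Set (EuclideanSpace ℝ (Fin N))} {p : ℝ} {u : EuclideanSpace ℝ (Fin N) → ℝ}

namespace IsFirstEigenfunction

theorem locallyLipschitzOn (hu : IsFirstEigenfunction p Ω (fun _ => 1) u) :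
    LocallyLipschitzOn Ω u := hu.1

theorem integrableOn_rpow (hu : IsFirstEigenfunction p Ω (fun _ => 1) u) :
    IntegrableOn (fun x => |u x| ^ p) Ω := by
  simpa using hu.2.2.1

theorem integrableOn_fderiv (hu : IsFirstEigenfunction p Ω (fun _ => 1) u) :
    IntegrableOn (fun x => ‖fderiv ℝ u x‖ ^ p) Ω := by
  simpa using hu.2.2.2.1

theorem integral_signedRpow (hu : IsFirstEigenfunction p Ω (fun _ => 1) u) :
    ∫ x in Ω, signedRpow p (u x) = 0 := by
  simpa [signedRpow] using hu.2.2.2.2.1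

theorem integral_fderiv (hu : IsFirstEigenfunction p Ω (fun _ => 1) u) :
    ∫ x in Ω, ‖fderiv ℝ u x‖ ^ p = muP p Ω (fun _ => 1) * ∫ x in Ω, |u x| ^ p := by
  simpa using hu.2.2.2.2.2

theorem neg (hu : IsFirstEigenfunction p Ω (fun _ => 1) u) :
    IsFirstEigenfunction p Ω (fun _ => 1) (fun x => -u x) := by
  refine ⟨fun x hx => ?_, ?_, ?_, ?_, ?_, ?_⟩
  · obtain ⟨K, t, ht, hK⟩ := hu.1 x hx
    exact ⟨K, t, ht, hK.neg⟩
  · simpa using hu.2.1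
  · simpa using hu.2.2.1
  · simpa [fderiv_fun_neg] using hu.2.2.2.1
  · simpa [integral_neg] using hu.2.2.2.2.1
  · simpa [fderiv_fun_neg] using hu.2.2.2.2.2

theorem integral_rpow_pos (hp : 1 < p) (hu : IsFirstEigenfunction p Ω (fun _ => 1) u) :
    0 < ∫ x in Ω, |u x| ^ p := by
  refine (integral_nonneg fun x => by positivity).lt_of_ne fun h => hu.2.1 ?_
  rw [eq_comm, integral_eq_zero_iff_of_nonneg (fun x => by positivity) hu.integrableOn_rpow] at h
  filter_upwards [h] with x hx
  simpa [Real.rpow_eq_zero (abs_nonneg _) (by linarith : p ≠ 0)] using hx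

end IsFirstEigenfunction

theorem LocallyLipschitzOn.lipschitzWith_comp {E : Type*} [PseudoEMetricSpace E] {s : Set E}
    {f : E → ℝ} (hf : LocallyLipschitzOn s f) {g : ℝ → ℝ} {C : NNReal} (hg : LipschitzWith C g) :
    LocallyLipschitzOn s (fun x => g (f x)) := fun x hx => by
  obtain ⟨K, t, ht, hK⟩ := hf hx
  exact ⟨C * K, t, ht, hg.comp_lipschitzOnWith hK⟩

theorem norm_fderiv_truncations_rpow_le {E : Type*} [NormedAddCommGroup E] [NormedSpace ℝ E]
    {f : E → ℝ} {x : E} (hf : ContinuousAt f x) (hp : 1 < p) (k : ℝ) :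
    ‖fderiv ℝ (fun y => min (f y) k) x‖ ^ p + ‖fderiv ℝ (fun y => max (f y - k) 0) x‖ ^ p ≤
      ‖fderiv ℝ f x‖ ^ p := by
  have hp0 : p ≠ 0 := by linarith
  rcases lt_trichotomy (f x) k with h | h | h
  · have h1 : (fun y => min (f y) k) =ᶠ[𝓝 x] f := by
      filter_upwards [hf.eventually_lt_const h] with y hy using min_eq_left hy.le
    have h2 : (fun y => max (f y - k) 0) =ᶠ[𝓝 x] fun _ => 0 := by
      filter_upwards [hf.eventually_lt_const h] with y hy using max_eq_right (by linarith)
    simp [h1.fderiv_eq, h2.fderiv_eq, hp0]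
  · have h1 : fderiv ℝ (fun y => min (f y) k) x = 0 :=
      IsLocalMax.fderiv_eq_zero (Eventually.of_forall fun y => by simp [h])
    have h2 : fderiv ℝ (fun y => max (f y - k) 0) x = 0 :=
      IsLocalMin.fderiv_eq_zero (Eventually.of_forall fun y => by simp [h])
    rw [h1, h2, norm_zero, Real.zero_rpow hp0, zero_add]
    positivity
  · have h1 : (fun y => min (f y) k) =ᶠ[𝓝 x] fun _ => k := by
      filter_upwards [hf.eventually_const_lt h] with y hy using min_eq_right hy.le
    have h2 : (fun y => max (f y - k) 0) =ᶠ[𝓝 x] fun y => f y - k := by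
      filter_upwards [hf.eventually_const_lt h] with y hy using max_eq_left (by linarith)
    simp [h1.fderiv_eq, h2.fderiv_eq, hp0, fderiv_sub_const]

theorem lipschitzWith_max_sub (k : ℝ) : LipschitzWith 1 fun y : ℝ => max (y - k) 0 := by
  have h : LipschitzWith 1 fun y : ℝ => y - k := by
    simpa using LipschitzWith.id.sub (LipschitzWith.const (α := ℝ) k)
  exact h.max_const 0

theorem integrableOn_abs_rpow_truncation {s : Set (EuclideanSpace ℝ (Fin N))} (hp : 1 < p)
    (hus : AEStronglyMeasurable u (volume.restrict s)) (hup : IntegrableOn (fun x => |u x| ^ p) s)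
    {k : ℝ} (hk : 0 ≤ k) : IntegrableOn (fun x => |max (u x - k) 0| ^ p) s := by
  refine Integrable.mono' hup ?_ (Eventually.of_forall fun x => ?_)
  · exact (continuous_abs.rpow_const fun _ => Or.inr (by linarith)).comp_aestronglyMeasurable
      ((lipschitzWith_max_sub k).continuous.comp_aestronglyMeasurable hus)
  · rw [Real.norm_of_nonneg (by positivity)]
    refine Real.rpow_le_rpow (abs_nonneg _) ?_ (by linarith)
    rw [abs_of_nonneg (le_max_right _ _)]
    exact max_le (by linarith [le_abs_self (u x)]) (abs_nonneg _)

theorem integrableOn_norm_fderiv_rpow_of_le {s : Set (EuclideanSpace ℝ (Fin N))} (hs : IsOpen s)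
    {v : EuclideanSpace ℝ (Fin N) → ℝ}
    (hud : IntegrableOn (fun x => ‖fderiv ℝ u x‖ ^ p) s)
    (hle : ∀ x ∈ s, ‖fderiv ℝ v x‖ ^ p ≤ ‖fderiv ℝ u x‖ ^ p) :
    IntegrableOn (fun x => ‖fderiv ℝ v x‖ ^ p) s := by
  refine Integrable.mono' hud ?_ ?_
  · exact ((measurable_fderiv ℝ v).norm.pow_const p).aestronglyMeasurable
  · refine ae_restrict_of_forall_mem hs.measurableSet fun x hx => ?_
    rw [Real.norm_of_nonneg (by positivity)]
    exact hle x hx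

/-- The Caccioppoli inequality on superlevel sets. -/
theorem IsFirstEigenfunction.integral_fderiv_truncation_le (hp : 1 < p) (hs : IsOpen Ω)
    (hc : Convex ℝ Ω) (hb : Bornology.IsBounded Ω) (hne : Ω.Nonempty)
    (hu : IsFirstEigenfunction p Ω (fun _ => 1) u) {k : ℝ} (hk : 0 ≤ k) :
    IntegrableOn (fun x => ‖fderiv ℝ (fun y => max (u y - k) 0) x‖ ^ p) Ω ∧
    ∫ x in Ω, ‖fderiv ℝ (fun y => max (u y - k) 0) x‖ ^ p ≤
      p * muP p Ω (fun _ => 1) * ∫ x in Ω, signedRpow p (u x) * max (u x - k) 0 := by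
  have hfin : IsFiniteMeasure (volume.restrict Ω) := ⟨by simpa using hb.measure_lt_top⟩
  have hcont := hu.locallyLipschitzOn.continuousOn
  have hum := hcont.aestronglyMeasurable hs.measurableSet (μ := volume)
  have hpt : ∀ x ∈ Ω, ‖fderiv ℝ (fun y => min (u y) k) x‖ ^ p +
      ‖fderiv ℝ (fun y => max (u y - k) 0) x‖ ^ p ≤ ‖fderiv ℝ u x‖ ^ p := fun x hx =>
    norm_fderiv_truncations_rpow_le (hcont.continuousAt (hs.mem_nhds hx)) hp k
  have hid : ∀ x, u x - min (u x) k = max (u x - k) 0 := fun x => by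
    rcases le_total (u x) k with h | h
    · rw [min_eq_left h, max_eq_right (by linarith), sub_self]
    · rw [min_eq_right h, max_eq_left (by linarith)]
  have hphi := integrableOn_abs_rpow_truncation hp hum hu.integrableOn_rpow hk
  have hd1 := integrableOn_norm_fderiv_rpow_of_le (v := fun y => min (u y) k) hs
    hu.integrableOn_fderiv fun x hx => by
      have := hpt x hx
      have : 0 ≤ ‖fderiv ℝ (fun y => max (u y - k) 0) x‖ ^ p := by positivity
      linarith
  have hd2 := integrableOn_norm_fderiv_rpow_of_le (v := fun y => max (u y - k) 0) hs
    hu.integrableOn_fderiv fun x hx => by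
      have := hpt x hx
      have : 0 ≤ ‖fderiv ℝ (fun y => min (u y) k) x‖ ^ p := by positivity
      linarith
  have hvp : IntegrableOn (fun x => |min (u x) k| ^ p) Ω := by
    have h := integrable_abs_sub_rpow hp hum
      ((lipschitzWith_max_sub k).continuous.comp_aestronglyMeasurable hum) hu.integrableOn_rpow hphi
    refine h.congr (Eventually.of_forall fun x => ?_)
    simp only [← hid, sub_sub_cancel]
  have hvl : LocallyLipschitzOn Ω fun x => min (u x) k :=
    hu.locallyLipschitzOn.lipschitzWith_comp (LipschitzWith.id.min_const k)
  have h := muP_one_mul_sub_le hp hs hc hb hne hvl hvp hd1 hcont hu.integrableOn_rpow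
    hu.integral_signedRpow
  simp only [hid] at h
  have hadd : (∫ x in Ω, ‖fderiv ℝ (fun y => min (u y) k) x‖ ^ p) +
      ∫ x in Ω, ‖fderiv ℝ (fun y => max (u y - k) 0) x‖ ^ p ≤ ∫ x in Ω, ‖fderiv ℝ u x‖ ^ p := by
    rw [← integral_add hd1 hd2]
    exact setIntegral_mono_on (hd1.add hd2) hu.integrableOn_fderiv hs.measurableSet hpt
  rw [hu.integral_fderiv] at hadd
  exact ⟨hd2, by linarith⟩

theorem lintegral_enorm_rpow_eq_ofReal {α F : Type*} [MeasurableSpace α] {m : Measure α}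
    [NormedAddCommGroup F] {f : α → F} (hp : 0 ≤ p) (hf : Integrable (fun x => ‖f x‖ ^ p) m) :
    ∫⁻ x, ‖f x‖ₑ ^ p ∂m = ENNReal.ofReal (∫ x, ‖f x‖ ^ p ∂m) := by
  rw [ofReal_integral_eq_lintegral_ofReal hf (Eventually.of_forall fun x => by positivity)]
  refine lintegral_congr fun x => ?_
  rw [← ENNReal.ofReal_rpow_of_nonneg (norm_nonneg _) hp, ofReal_norm]

/-- A lower bound for the first eigenvalue in terms of the diameter. -/
theorem IsFirstEigenfunction.one_le_mul_muP (hp : 1 < p) (hs : IsOpen Ω)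
    (hc : Convex ℝ Ω) (hb : Bornology.IsBounded Ω) (hne : Ω.Nonempty)
    (hu : IsFirstEigenfunction p Ω (fun _ => 1) u) :
    1 ≤ 2 ^ N * (muP p Ω (fun _ => 1) * Metric.diam Ω ^ p) := by
  have hfin : IsFiniteMeasure (volume.restrict Ω) := ⟨by simpa using hb.measure_lt_top⟩
  have hum := hu.locallyLipschitzOn.continuousOn.aestronglyMeasurable hs.measurableSet (μ := volume)
  have hS := hu.integral_rpow_pos hp
  have hdiam : ∀ x ∈ Ω, ∀ y ∈ Ω, ‖y - x‖ ≤ Metric.diam Ω := fun x hx y hy => by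
    rw [← dist_eq_norm]; exact Metric.dist_le_diam_of_mem hb hy hx
  have hmu := muP_one_nonneg p Ω
  have h := lintegral_enorm_sub_rpow_le_fderiv volume hp hs hc hu.locallyLipschitzOn
    Metric.diam_nonneg hdiam
  rw [lintegral_enorm_rpow_eq_ofReal (by linarith) hu.integrableOn_fderiv, hu.integral_fderiv,
    finrank_euclideanSpace_fin] at h
  have hlow : ∀ x, ENNReal.ofReal (∫ z in Ω, |u z| ^ p) ≤ ∫⁻ z in Ω, ‖u x - u z‖ₑ ^ p := by
    intro x
    have hi := integrable_abs_sub_rpow hp hum (aestronglyMeasurable_const (b := u x))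
      hu.integrableOn_rpow (integrable_const _)
    have h1 := integral_abs_rpow_le_sub_const hp hum hu.integrableOn_rpow hu.integral_signedRpow (u x)
    have h2 := lintegral_enorm_rpow_eq_ofReal (f := fun z => u z - u x) (by linarith) hi
    simp_rw [enorm_sub_rev (u x)]
    rw [h2]
    exact ENNReal.ofReal_le_ofReal h1
  have h3 : ENNReal.ofReal (∫ z in Ω, |u z| ^ p) * volume Ω ≤
      ∫⁻ x in Ω, (∫⁻ z in Ω, ‖u x - u z‖ₑ ^ p) := by
    rw [← setLIntegral_const]
    exact lintegral_mono hlow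
  have h4 := h3.trans h
  have hV0 : volume Ω ≠ 0 := (hs.measure_pos _ hne).ne'
  have hVt : volume Ω ≠ ⊤ := hb.measure_lt_top.ne
  rw [mul_right_comm, ENNReal.mul_le_mul_iff_left hV0 hVt, ← ENNReal.ofReal_mul (by positivity),
    ENNReal.ofReal_le_ofReal_iff (by positivity)] at h4
  refine le_of_mul_le_mul_right ?_ hS
  linarith

end Eigenfunction

section LevelSets

variable {N : ℕ} {Ω : Set (EuclideanSpace ℝ (Fin N))} {p : ℝ} {u : EuclideanSpace ℝ (Fin N) → ℝ}

theorem signedRpow_mul_truncation_le (hp : 1 < p) {l m : ℝ} (hl : 0 ≤ l) (hlm : l < m) (t : ℝ) :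
    signedRpow p t * max (t - m) 0 ≤ (m / (m - l)) ^ (p - 1) * |max (t - l) 0| ^ p := by
  have hml : 0 < m - l := sub_pos.2 hlm
  have hm : 0 < m := by linarith
  rcases le_total t m with h | h
  · rw [max_eq_right (by linarith), mul_zero]
    positivity
  · have ht : 0 < t := by linarith
    have htl : 0 < t - l := by linarith
    rw [max_eq_left (by linarith), max_eq_left htl.le, abs_of_pos htl,
      signedRpow_of_nonneg hp ht.le]
    have h1 : t ≤ m / (m - l) * (t - l) := by
      rw [div_mul_eq_mul_div, le_div_iff₀ hml]
      nlinarith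
    calc t ^ (p - 1) * (t - m) ≤ (m / (m - l) * (t - l)) ^ (p - 1) * (t - l) := by
          gcongr
      _ = (m / (m - l)) ^ (p - 1) * ((t - l) ^ (p - 1) * (t - l)) := by
          rw [Real.mul_rpow (by positivity) htl.le, mul_assoc]
      _ = _ := by rw [← Real.rpow_add_one htl.ne', sub_add_cancel]

theorem measureReal_truncation_ne_zero_le (hp : 1 < p) (hs : IsOpen Ω)
    (hb : Bornology.IsBounded Ω) {l m : ℝ} (hlm : l < m)
    (hi : IntegrableOn (fun x => |max (u x - l) 0| ^ p) Ω) :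
    (m - l) ^ p * volume.real {x ∈ Ω | max (u x - m) 0 ≠ 0} ≤ ∫ x in Ω, |max (u x - l) 0| ^ p := by
  have hml : 0 < m - l := sub_pos.2 hlm
  refine le_trans ?_ (mul_meas_ge_le_integral_of_nonneg
    (Eventually.of_forall fun x => by positivity) hi ((m - l) ^ p))
  rw [measureReal_restrict_apply' hs.measurableSet]
  gcongr
  · exact ((measure_mono inter_subset_right).trans_lt hb.measure_lt_top).ne
  rintro x ⟨hx, hxm⟩
  refine ⟨?_, hx⟩
  have hxm' : m < u x := by
    by_contra! h
    exact hxm (max_eq_right (by linarith))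
  rw [mem_ofPred_eq]
  have h1 : m - l ≤ max (u x - l) 0 := (by linarith : m - l ≤ u x - l).trans (le_max_left _ _)
  exact Real.rpow_le_rpow hml.le (h1.trans (le_abs_self _)) (by linarith)

/-- One step of the De Giorgi iteration. -/
theorem IsFirstEigenfunction.integral_truncation_le (hp : 1 < p) (hs : IsOpen Ω)
    (hc : Convex ℝ Ω) (hb : Bornology.IsBounded Ω) (hne : Ω.Nonempty)
    (hu : IsFirstEigenfunction p Ω (fun _ => 1) u) {l m r : ℝ} (hl : 0 ≤ l) (hlm : l < m)
    (hr : 0 < r) (hr1 : r ≤ 1 / 2)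
    (hsmall : 2 * ∫ x in Ω, |max (u x - l) 0| ^ p ≤ r ^ N * volume.real Ω * (m - l) ^ p) :
    ∫ x in Ω, |max (u x - m) 0| ^ p ≤
      p * 2 ^ (N + 1) * r ^ p * (muP p Ω (fun _ => 1) * Metric.diam Ω ^ p) *
        (m / (m - l)) ^ (p - 1) * ∫ x in Ω, |max (u x - l) 0| ^ p := by
  have hfin : IsFiniteMeasure (volume.restrict Ω) := ⟨by simpa using hb.measure_lt_top⟩
  have hml : 0 < m - l := sub_pos.2 hlm
  have hm : 0 ≤ m := by linarith
  have hum := hu.locallyLipschitzOn.continuousOn.aestronglyMeasurable hs.measurableSet (μ := volume)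
  have hil := integrableOn_abs_rpow_truncation hp hum hu.integrableOn_rpow hl
  have him := integrableOn_abs_rpow_truncation hp hum hu.integrableOn_rpow hm
  have hdiam : ∀ x ∈ Ω, ∀ y ∈ Ω, ‖y - x‖ ≤ Metric.diam Ω := fun x hx y hy => by
    rw [← dist_eq_norm]; exact Metric.dist_le_diam_of_mem hb hy hx
  have hmu := muP_one_nonneg p Ω
  have hVt : volume Ω ≠ ⊤ := hb.measure_lt_top.ne
  have hcheb := measureReal_truncation_ne_zero_le hp hs hb hlm hil
  have hsupp : 2 * volume {x ∈ Ω | max (u x - m) 0 ≠ 0} ≤ ENNReal.ofReal (r ^ N) * volume Ω := by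
    have hreal : 2 * volume.real {x ∈ Ω | max (u x - m) 0 ≠ 0} ≤ r ^ N * volume.real Ω := by
      refine le_of_mul_le_mul_right ?_ (Real.rpow_pos_of_pos hml p)
      linarith
    have ht : volume {x ∈ Ω | max (u x - m) 0 ≠ 0} ≠ ⊤ :=
      ((measure_mono fun x hx => hx.1).trans_lt hb.measure_lt_top).ne
    have h := ENNReal.ofReal_le_ofReal hreal
    rwa [ENNReal.ofReal_mul (by norm_num), ENNReal.ofReal_mul (by positivity),
      ofReal_measureReal ht, ofReal_measureReal hVt, ENNReal.ofReal_ofNat] at h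
  obtain ⟨hdi, hcacc⟩ := hu.integral_fderiv_truncation_le hp hs hc hb hne hm
  have hfk := lintegral_enorm_rpow_le_of_small_support volume hp hs hc hne hVt
    (hu.locallyLipschitzOn.lipschitzWith_comp (lipschitzWith_max_sub m)) hr hr1
    Metric.diam_nonneg hdiam (by rwa [finrank_euclideanSpace_fin])
  rw [lintegral_enorm_rpow_eq_ofReal (by linarith) hdi,
    lintegral_enorm_rpow_eq_ofReal (f := fun x => max (u x - m) 0) (by linarith) him,
    ← ENNReal.ofReal_mul (by positivity), finrank_euclideanSpace_fin,
    ENNReal.ofReal_le_ofReal_iff (mul_nonneg (by positivity)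
      (integral_nonneg fun x => by positivity))] at hfk
  have hi : ∫ x in Ω, signedRpow p (u x) * max (u x - m) 0 ≤
      (m / (m - l)) ^ (p - 1) * ∫ x in Ω, |max (u x - l) 0| ^ p := by
    rw [← integral_const_mul]
    exact integral_mono (integrable_signedRpow_mul hp hum
      ((lipschitzWith_max_sub m).continuous.comp_aestronglyMeasurable hum) hu.integrableOn_rpow him)
      (hil.const_mul _) fun x => signedRpow_mul_truncation_le hp hl hlm (u x)
  calc _ ≤ 2 ^ (N + 1) * (r * Metric.diam Ω) ^ p *
        ∫ x in Ω, ‖fderiv ℝ (fun y => max (u y - m) 0) x‖ ^ p := hfk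
    _ ≤ 2 ^ (N + 1) * (r * Metric.diam Ω) ^ p * (p * muP p Ω (fun _ => 1) *
        ((m / (m - l)) ^ (p - 1) * ∫ x in Ω, |max (u x - l) 0| ^ p)) := by
      have : 0 ≤ Metric.diam Ω := Metric.diam_nonneg
      gcongr
      exact hcacc.trans (by gcongr)
    _ = _ := by
      rw [Real.mul_rpow hr.le Metric.diam_nonneg]
      ring

end LevelSets

section Iteration

variable {N : ℕ} {Ω : Set (EuclideanSpace ℝ (Fin N))} {p : ℝ} {u : EuclideanSpace ℝ (Fin N) → ℝ}

theorem deGiorgi_exponent_le {n b a j : ℝ} (hp : 1 < p) (hn : 2 ≤ n) (hb : -n ≤ b)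
    (ha : n ^ 2 + 5 * n ≤ a) :
    p + (n + 1) + p * ((1 + (j + 1) * p - (p + n * (p - 1) / p) * j - (p * a + n * b)) / n) + b +
        (j + 1) * (p - 1) - (p + n * (p - 1) / p) * j ≤ -(p + n * (p - 1) / p) * (j + 1) := by
  have hp0 : p ≠ 0 := by linarith
  have hn0 : n ≠ 0 := by linarith
  have h1 : p * ((1 + (j + 1) * p - (p + n * (p - 1) / p) * j - (p * a + n * b)) / n) =
      p / n + p ^ 2 / n - j * (p - 1) - p ^ 2 * (a / n) - p * b := by
    field_simp
    ring
  have h2 : n + 5 ≤ a / n := by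
    rw [le_div_iff₀ (by linarith)]
    nlinarith
  have h3 : p ^ 2 * (n + 5) ≤ p ^ 2 * (a / n) := by gcongr
  have h4 : p / n ≤ p / 2 := by gcongr
  have h5 : p ^ 2 / n ≤ p ^ 2 / 2 := by gcongr
  have h6 : n * (p - 1) / p ≤ n * (p ^ 2 - p) := by
    rw [div_le_iff₀ (by linarith)]
    have : 0 ≤ n * ((p - 1) * ((p - 1) * (p + 1))) :=
      mul_nonneg (by linarith) (mul_nonneg (by linarith) (mul_nonneg (by linarith) (by linarith)))
    nlinarith
  have h7 : 0 ≤ (p - 1) * (b + n) := mul_nonneg (by linarith) (by linarith)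
  rw [h1]
  nlinarith

theorem deGiorgi_radius_exponent_le {n b a j : ℝ} (hp : 1 < p) (hn : 2 ≤ n) (hb : -n ≤ b)
    (ha : n ^ 2 + 5 * n ≤ a) (hj : 0 ≤ j) :
    (1 + (j + 1) * p - (p + n * (p - 1) / p) * j - (p * a + n * b)) / n ≤ -1 := by
  rw [div_le_iff₀ (by linarith)]
  have h1 : 0 ≤ n * (p - 1) / p * j :=
    mul_nonneg (div_nonneg (mul_nonneg (by linarith) (by linarith)) (by linarith)) hj
  have h2 : p * (n ^ 2 + 5 * n) ≤ p * a := by gcongr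
  have h3 : 0 ≤ n * (b + n) := mul_nonneg (by linarith) (by linarith)
  have h4 : 0 ≤ (p - 1) * n ^ 2 := mul_nonneg (by linarith) (by positivity)
  have h5 : p * 2 ≤ p * n := by gcongr
  have h6 : n * 1 ≤ n * p := by gcongr
  nlinarith

/-- The decay of the truncated norms along the levels `k * (1 - 2 ^ (-j))`. -/
theorem IsFirstEigenfunction.integral_truncation_level_le (hp : 1 < p) (hN : 2 ≤ N) (hs : IsOpen Ω)
    (hc : Convex ℝ Ω) (hb : Bornology.IsBounded Ω) (hne : Ω.Nonempty)
    (hu : IsFirstEigenfunction p Ω (fun _ => 1) u) {a b k : ℝ}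
    (ha : (N : ℝ) ^ 2 + 5 * N ≤ a) (hb1 : muP p Ω (fun _ => 1) * Metric.diam Ω ^ p = 2 ^ b)
    (hk0 : 0 < k)
    (hk : k ^ p = 2 ^ (p * a + N * b) * ((∫ x in Ω, |u x| ^ p) / volume.real Ω)) (j : ℕ) :
    ∫ x in Ω, |max (u x - k * (1 - 2 ^ (-(j : ℝ)))) 0| ^ p ≤
      (∫ x in Ω, |u x| ^ p) * 2 ^ (-(p + N * (p - 1) / p) * j) := by
  have hS := hu.integral_rpow_pos hp
  set S := ∫ x in Ω, |u x| ^ p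
  have hn : (2 : ℝ) ≤ N := by exact_mod_cast hN
  have hV : 0 < volume.real Ω :=
    ENNReal.toReal_pos (hs.measure_pos _ hne).ne' hb.measure_lt_top.ne
  have hb2 : -(N : ℝ) ≤ b := by
    have h := hu.one_le_mul_muP hp hs hc hb hne
    rw [hb1, ← Real.rpow_natCast, ← Real.rpow_add two_pos,
      ← Real.rpow_zero (2 : ℝ), Real.rpow_le_rpow_left_iff one_lt_two] at h
    linarith
  induction j with
  | zero =>
    simp only [Nat.cast_zero, neg_zero, Real.rpow_zero, sub_self, mul_zero, sub_zero, mul_one]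
    refine integral_mono_of_nonneg (Eventually.of_forall fun x => by positivity)
      hu.integrableOn_rpow (Eventually.of_forall fun x => ?_)
    refine Real.rpow_le_rpow (abs_nonneg _) ?_ (by linarith)
    rw [abs_of_nonneg (le_max_right _ _)]
    exact max_le (le_abs_self _) (abs_nonneg _)
  | succ j ih =>
    set q : ℝ := 2 ^ (-((j : ℝ) + 1)) with hq
    have hq0 : 0 < q := by positivity
    have h2q : (2 : ℝ) ^ (-(j : ℝ)) = 2 * q := by
      rw [hq, neg_add, Real.rpow_add two_pos, Real.rpow_neg_one]
      ring
    have hq1 : 2 * q ≤ 1 := by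
      rw [← h2q]
      exact Real.rpow_le_one_of_one_le_of_nonpos one_le_two (by simp)
    push_cast
    rw [h2q] at ih
    set e : ℝ := (1 + ((j : ℝ) + 1) * p - (p + N * (p - 1) / p) * j - (p * a + N * b)) / N with he
    have hml : k * (1 - q) - k * (1 - 2 * q) = k * q := by ring
    have hrN : ((2 : ℝ) ^ e) ^ N =
        2 ^ (1 + ((j : ℝ) + 1) * p - (p + N * (p - 1) / p) * j - (p * a + N * b)) := by
      rw [← Real.rpow_natCast, ← Real.rpow_mul two_pos.le, he, div_mul_cancel₀ _ (by linarith)]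
    have hqp : q ^ p = 2 ^ (-(((j : ℝ) + 1) * p)) := by
      rw [hq, ← Real.rpow_mul two_pos.le, neg_mul]
    have hsmall : 2 * ∫ x in Ω, |max (u x - k * (1 - 2 * q)) 0| ^ p ≤
        ((2 : ℝ) ^ e) ^ N * volume.real Ω * (k * (1 - q) - k * (1 - 2 * q)) ^ p := by
      rw [hml, Real.mul_rpow hk0.le hq0.le, hk, hrN, hqp]
      calc _ ≤ 2 * (S * 2 ^ (-(p + N * (p - 1) / p) * (j : ℝ))) := by gcongr
        _ = (2 ^ (1 + ((j : ℝ) + 1) * p - (p + N * (p - 1) / p) * j - (p * a + N * b)) *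
              2 ^ (p * a + N * b) * 2 ^ (-(((j : ℝ) + 1) * p))) *
              (volume.real Ω * (S / volume.real Ω)) := by
          rw [← Real.rpow_add two_pos, ← Real.rpow_add two_pos, mul_div_cancel₀ _ hV.ne']
          have : (2 : ℝ) = 2 ^ (1 : ℝ) := (Real.rpow_one 2).symm
          nth_rewrite 1 [this]
          rw [mul_left_comm, ← Real.rpow_add two_pos, mul_comm]
          ring_nf
        _ = _ := by ring
    have hr1 : (2 : ℝ) ^ e ≤ 1 / 2 := by
      rw [one_div, ← Real.rpow_neg_one]
      exact Real.rpow_le_rpow_of_exponent_le one_le_two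
        (deGiorgi_radius_exponent_le hp hn hb2 ha (by positivity))
    have hstep := hu.integral_truncation_le hp hs hc hb hne (mul_nonneg hk0.le (by linarith))
      (by nlinarith) (by positivity) hr1 hsmall
    have hratio : k * (1 - q) / (k * (1 - q) - k * (1 - 2 * q)) ≤ 2 ^ ((j : ℝ) + 1) := by
      rw [hml, mul_div_mul_left _ _ hk0.ne', div_le_iff₀ hq0, hq, ← Real.rpow_add two_pos]
      simp only [add_neg_cancel, Real.rpow_zero]
      linarith
    have hratio0 : 0 ≤ k * (1 - q) / (k * (1 - q) - k * (1 - 2 * q)) := by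
      rw [hml]
      exact div_nonneg (mul_nonneg hk0.le (by linarith)) (by positivity)
    have hp2 : p ≤ 2 ^ p := by
      have h := one_add_mul_self_le_rpow_one_add (s := 1) (by norm_num) hp.le
      rw [one_add_one_eq_two] at h
      linarith
    have hp1 : 0 ≤ p - 1 := by linarith
    rw [hb1] at hstep
    refine hstep.trans ?_
    calc _ ≤ 2 ^ p * 2 ^ (N + 1) * ((2 : ℝ) ^ e) ^ p * 2 ^ b * (2 ^ ((j : ℝ) + 1)) ^ (p - 1) *
          (S * 2 ^ (-(p + N * (p - 1) / p) * (j : ℝ))) := by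
          gcongr
      _ = S * 2 ^ (p + ((N : ℝ) + 1) + p * e + b + (j + 1) * (p - 1) -
            (p + N * (p - 1) / p) * j) := by
          rw [← Real.rpow_natCast, ← Real.rpow_mul two_pos.le, ← Real.rpow_mul two_pos.le,
            mul_left_comm]
          simp only [← Real.rpow_add two_pos]
          push_cast
          ring_nf
      _ ≤ _ := by
          gcongr
          · norm_num
          · exact deGiorgi_exponent_le hp hn hb2 ha

theorem IsFirstEigenfunction.ae_le_const (hp : 1 < p) (hN : 2 ≤ N) (hs : IsOpen Ω)
    (hc : Convex ℝ Ω) (hb : Bornology.IsBounded Ω) (hne : Ω.Nonempty)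
    (hu : IsFirstEigenfunction p Ω (fun _ => 1) u) {K : ℝ} (hK : 2 ^ (N ^ 2 + 5 * N) ≤ K) :
    ∀ᵐ x ∂(volume.restrict Ω), u x ≤ K *
      (muP p Ω (fun _ => 1) * Metric.diam Ω ^ p) ^ ((N : ℝ) / p) *
        ((∫ y in Ω, |u y| ^ p) / volume.real Ω) ^ (1 / p) := by
  have hS := hu.integral_rpow_pos hp
  have hV : 0 < volume.real Ω :=
    ENNReal.toReal_pos (hs.measure_pos _ hne).ne' hb.measure_lt_top.ne
  have hp0 : p ≠ 0 := by linarith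
  have hK0 : 0 < K := lt_of_lt_of_le (by positivity) hK
  have hL : 0 < muP p Ω (fun _ => 1) * Metric.diam Ω ^ p := by
    have h := hu.one_le_mul_muP hp hs hc hb hne
    by_contra! h0
    have := mul_nonpos_of_nonneg_of_nonpos (by positivity : (0 : ℝ) ≤ 2 ^ N) h0
    linarith
  set L := muP p Ω (fun _ => 1) * Metric.diam Ω ^ p with hLdef
  set S := ∫ y in Ω, |u y| ^ p
  set k := K * L ^ ((N : ℝ) / p) * (S / volume.real Ω) ^ (1 / p) with hkdef
  have hk0 : 0 < k := by positivity
  have hLb : L = 2 ^ Real.logb 2 L := (Real.rpow_logb two_pos (by norm_num) hL).symm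
  have hKa : K = 2 ^ Real.logb 2 K := (Real.rpow_logb two_pos (by norm_num) hK0).symm
  have ha : (N : ℝ) ^ 2 + 5 * N ≤ Real.logb 2 K := by
    rw [Real.le_logb_iff_rpow_le one_lt_two hK0]
    exact_mod_cast hK
  have hk : k ^ p = 2 ^ (p * Real.logb 2 K + N * Real.logb 2 L) * (S / volume.real Ω) := by
    rw [hkdef, Real.mul_rpow (by positivity) (by positivity), Real.mul_rpow (by positivity)
      (by positivity), ← Real.rpow_mul (by positivity), ← Real.rpow_mul (by positivity),
      one_div_mul_cancel hp0, Real.rpow_one, div_mul_cancel₀ _ hp0, Real.rpow_add two_pos,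
      mul_comm p, mul_comm (N : ℝ), Real.rpow_mul two_pos.le, Real.rpow_mul two_pos.le,
      ← hKa, ← hLb]
  have hdecay := hu.integral_truncation_level_le hp hN hs hc hb hne ha hLb hk0 hk
  have hum := hu.locallyLipschitzOn.continuousOn.aestronglyMeasurable hs.measurableSet (μ := volume)
  have hle : ∀ j : ℕ, ∫ x in Ω, |max (u x - k) 0| ^ p ≤
      S * ((2 : ℝ) ^ (-(p + N * (p - 1) / p))) ^ j := by
    intro j
    have hq : (0 : ℝ) < 2 ^ (-(j : ℝ)) := by positivity
    have hq1 : (2 : ℝ) ^ (-(j : ℝ)) ≤ 1 :=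
      Real.rpow_le_one_of_one_le_of_nonpos one_le_two (by simp)
    rw [← Real.rpow_natCast, ← Real.rpow_mul two_pos.le]
    refine le_trans (integral_mono
      (integrableOn_abs_rpow_truncation hp hum hu.integrableOn_rpow hk0.le)
      (integrableOn_abs_rpow_truncation hp hum hu.integrableOn_rpow
        (mul_nonneg hk0.le (by linarith))) fun x => ?_) (hdecay j)
    refine Real.rpow_le_rpow (abs_nonneg _) ?_ (by linarith)
    rw [abs_of_nonneg (le_max_right _ _), abs_of_nonneg (le_max_right _ _)]
    exact max_le_max_right 0 (by nlinarith)
  have hlim : Tendsto (fun j : ℕ => S * ((2 : ℝ) ^ (-(p + N * (p - 1) / p))) ^ j) atTop (𝓝 0) := by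
    have h := (tendsto_pow_atTop_nhds_zero_of_lt_one
      (by positivity : (0 : ℝ) ≤ 2 ^ (-(p + N * (p - 1) / p)))
      (Real.rpow_lt_one_of_one_lt_of_neg one_lt_two ?_)).const_mul S
    · simpa using h
    · have : 0 ≤ N * (p - 1) / p :=
        div_nonneg (mul_nonneg (by positivity) (by linarith)) (by linarith)
      linarith
  have hzero : ∫ x in Ω, |max (u x - k) 0| ^ p = 0 :=
    le_antisymm (ge_of_tendsto' hlim hle) (integral_nonneg fun x => by positivity)
  rw [integral_eq_zero_iff_of_nonneg (fun x => by positivity)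
    (integrableOn_abs_rpow_truncation hp hum hu.integrableOn_rpow hk0.le)] at hzero
  filter_upwards [hzero] with x hx
  simpa [Real.rpow_eq_zero (abs_nonneg _) hp0] using hx

end Iteration

section Constant

theorem volume_ball_le_two_pow (k : ℕ) :
    (volume (Metric.ball (0 : EuclideanSpace ℝ (Fin k)) 1)).toReal ≤ 2 ^ k := by
  have hsub : Metric.ball (0 : EuclideanSpace ℝ (Fin k)) 1 ⊆
      WithLp.ofLp ⁻¹' (Icc (fun _ => -1 : Fin k → ℝ) fun _ => 1) := by
    intro x hx
    rw [mem_ball_zero_iff] at hx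
    have h : ∀ i, |x i| ≤ 1 := fun i => (PiLp.norm_apply_le x i).trans hx.le
    exact ⟨fun i => (abs_le.1 (h i)).1, fun i => (abs_le.1 (h i)).2⟩
  have hle := measure_mono (μ := volume) hsub
  rw [(PiLp.volume_preserving_ofLp (Fin k)).measure_preimage measurableSet_Icc.nullMeasurableSet,
    Real.volume_Icc_pi] at hle
  have h := ENNReal.toReal_mono (by simp) hle
  norm_num at h
  exact h

theorem two_pow_le_Kinf {k : ℕ} (hk : 2 ≤ k) : 2 ^ (k ^ 2 + 5 * k) ≤ Kinf k := by
  have hk2 : (2 : ℝ) ≤ k := by exact_mod_cast hk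
  have hball : 0 < (volume (Metric.ball (0 : EuclideanSpace ℝ (Fin k)) 1)).toReal :=
    ENNReal.toReal_pos (Metric.measure_ball_pos _ _ one_pos).ne' measure_ball_lt_top.ne
  have h1 : ((2 : ℝ) ^ k)⁻¹ ≤ ((volume (Metric.ball (0 : EuclideanSpace ℝ (Fin k)) 1)).toReal)⁻¹ :=
    inv_anti₀ hball (volume_ball_le_two_pow k)
  have h2 : (2 : ℝ) ^ (k + 3) ≤ 1 + 4 * (k : ℝ) ^ (k + 1) := by
    have : (2 : ℝ) ^ (k + 1) ≤ (k : ℝ) ^ (k + 1) := by gcongr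
    have : (2 : ℝ) ^ (k + 3) = 4 * 2 ^ (k + 1) := by ring
    linarith
  have h3 : (2 : ℝ) ≤ ((k : ℝ) / ((k : ℝ) - 1)) ^ (k - 1) := by
    have hk1 : (0 : ℝ) < k - 1 := by linarith
    have h := one_add_mul_le_pow (a := 1 / ((k : ℝ) - 1)) (by
      have : 0 ≤ 1 / ((k : ℝ) - 1) := by positivity
      linarith) (k - 1)
    rw [Nat.cast_sub (by omega), Nat.cast_one, mul_one_div_cancel hk1.ne'] at h
    have h4 : (k : ℝ) / (k - 1) = 1 + 1 / (k - 1) := by field_simp; ring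
    rw [h4]
    linarith
  have h4 : (2 : ℝ) ^ k ≤ ((k : ℝ) / ((k : ℝ) - 1)) ^ (k * (k - 1)) := by
    rw [mul_comm, pow_mul]
    gcongr
  calc (2 : ℝ) ^ (k ^ 2 + 5 * k) = 2 ^ (2 * k) * ((2 : ℝ) ^ k)⁻¹ * (2 ^ (k + 3)) ^ k * 2 ^ k := by
        rw [mul_right_comm, inv_mul_cancel_right₀ (by positivity), ← pow_mul, ← pow_add]
        ring_nf
    _ ≤ Kinf k := by
        unfold Kinf
        gcongr

end Constant

/-- Proposition 3.2: sharp `L^∞` bound for first Neumann eigenfunctions.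
If `ū` is a first eigenfunction for `μ_p(Ω)` on an open bounded convex `Ω ⊂ ℝ^N`, then
`‖ū‖_{L^∞(Ω)} ≤ K_∞(N) μ_p(Ω)^{N/p} (D_Ω^N/|Ω|^{1/p}) ‖ū‖_{L^p(Ω)}`. -/
theorem stmt6 (p : ℝ) (hp : 1 < p) (N : ℕ) (hN : 2 ≤ N)
    (Ω : Set (EuclideanSpace ℝ (Fin N)))
    (hopen : IsOpen Ω) (hconv : Convex ℝ Ω) (hbdd : Bornology.IsBounded Ω) (hne : Ω.Nonempty)
    (u : EuclideanSpace ℝ (Fin N) → ℝ)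
    (hu : IsFirstEigenfunction p Ω (fun _ => 1) u) :
    ∀ᵐ x ∂(volume.restrict Ω),
      |u x| ≤ Kinf N * muP p Ω (fun _ => 1) ^ ((N : ℝ) / p) *
        (Metric.diam Ω ^ (N : ℕ) / (volume Ω).toReal ^ ((1 : ℝ) / p)) *
        (∫ y in Ω, |u y| ^ p) ^ ((1 : ℝ) / p) := by
  have hK := two_pow_le_Kinf hN
  have hrhs : Kinf N * muP p Ω (fun _ => 1) ^ ((N : ℝ) / p) *
        (Metric.diam Ω ^ (N : ℕ) / (volume Ω).toReal ^ ((1 : ℝ) / p)) *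
        (∫ y in Ω, |u y| ^ p) ^ ((1 : ℝ) / p) =
      Kinf N * (muP p Ω (fun _ => 1) * Metric.diam Ω ^ p) ^ ((N : ℝ) / p) *
        ((∫ y in Ω, |u y| ^ p) / volume.real Ω) ^ (1 / p) := by
    have hdiam : 0 ≤ Metric.diam Ω := Metric.diam_nonneg
    rw [Real.mul_rpow (muP_one_nonneg p Ω) (by positivity), ← Real.rpow_mul hdiam,
      mul_div_cancel₀ _ (by linarith : p ≠ 0), Real.rpow_natCast,
      Real.div_rpow (integral_nonneg fun x => by positivity) measureReal_nonneg, Measure.real]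
    ring
  rw [hrhs]
  have h1 := hu.ae_le_const hp hN hopen hconv hbdd hne hK
  have h2 := hu.neg.ae_le_const hp hN hopen hconv hbdd hne hK
  simp only [abs_neg] at h2
  filter_upwards [h1, h2] with x hx1 hx2
  exact abs_le.2 ⟨by linarith, hx1⟩
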